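/- Let D_{n,k} be the number of nodes with out-degree k (0 ≤ k ≤ m) in the random m-ary search tree 𝒯_n with n keys. If m ≤ 26, then, as n → ∞, (D_{n,k} − μ_k·n)/√n converges in distribution to N(0, σ_k²), where σ_k² is some positive constant and μ_k = (m−1)/(2(H_m − 1)(m+1)) if k = 0, and μ_k = 1/((H_m − 1)·m·(m+1)) if 1 ≤ k ≤ m. -/

import Mathlib

open scoped BigOperators

namespace MSTpaper

/-- The marked ordered tree underlying an `m`-ary search tree: a node either holds
`j` keys and has no children (`lf j`, with `j ≤ m - 2`; `lf 0` is an external node),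
or is full, holding `m - 1` keys, and has `m` (possibly external) children. -/
inductive MTree (m : ℕ) : Type
  | lf : ℕ → MTree m
  | nd : (Fin m → MTree m) → MTree m

namespace MTree

/-- The number of keys of an `m`-ary search tree. -/
def keys {m : ℕ} : MTree m → ℕ
  | lf j => j
  | nd c => (m - 1) + ∑ i, keys (c i)

end MTree

/-- The `m`-ary search tree built from a list of (distinct) keys: the first `m - 1`
keys go into the root, and each further key is passed to the subtree corresponding to
the interval (among the intervals determined by the root keys) it belongs to. -/
def build (m : ℕ) (l : List ℕ) : MTree m :=
  if h : 2 ≤ m ∧ m - 1 ≤ l.length then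
    MTree.nd (fun i =>
      build m ((l.drop (m - 1)).filter
        (fun x => (l.take (m - 1)).countP (fun p => decide (p < x)) == (i : ℕ))))
  else MTree.lf l.length
termination_by l.length
decreasing_by
  exact lt_of_le_of_lt (List.length_filter_le _ _) (by rw [List.length_drop]; omega)

open Classical in
/-- The number of fringe subtrees of a tree that are isomorphic (as marked ordered
trees, i.e. equal) to the fixed tree `T`. -/
noncomputable def countEq {m : ℕ} (T : MTree m) : MTree m → ℕ
  | MTree.lf j => if MTree.lf j = T then 1 else 0
  | MTree.nd c => (if MTree.nd c = T then 1 else 0) + ∑ i, countEq T (c i)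

open Classical in
/-- The number of fringe subtrees with exactly `k` keys. -/
noncomputable def countKeys {m : ℕ} (k : ℕ) : MTree m → ℕ
  | MTree.lf j => if j = k then 1 else 0
  | MTree.nd c => (if MTree.keys (MTree.nd c) = k then 1 else 0) + ∑ i, countKeys k (c i)

/-- The random `m`-ary search tree with `n` keys, as a function of the permutation
(the order in which the keys `1, …, n` arrive). -/
def mst (m n : ℕ) (π : Equiv.Perm (Fin n)) : MTree m :=
  build m ((List.finRange n).map (fun i => ((π i : ℕ))))

/-- Expectation of a functional of the random `m`-ary search tree, i.e. the average
over the `n!` (uniformly distributed) permutations. -/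
noncomputable def pexp (n : ℕ) (f : Equiv.Perm (Fin n) → ℝ) : ℝ :=
  (∑ π : Equiv.Perm (Fin n), f π) / (Nat.factorial n : ℝ)

/-- The harmonic number `H_m`. -/
noncomputable def Hm (m : ℕ) : ℝ := ∑ i ∈ Finset.range m, (1 : ℝ) / ((i : ℝ) + 1)

open MeasureTheory in
/-- `W_n` converges in distribution, under the uniformly random permutation model,
to the centered normal distribution with variance `v`. -/
def TendstoGauss (W : (n : ℕ) → Equiv.Perm (Fin n) → ℝ) (v : NNReal) : Prop :=
  ∀ f : BoundedContinuousFunction ℝ ℝ,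
    Filter.Tendsto (fun n => pexp n (fun π => f (W n π)))
      Filter.atTop (nhds (∫ x, f x ∂(ProbabilityTheory.gaussianReal 0 v)))

end MSTpaper

namespace MSTpaper

open Classical in
/-- The number of (internal) nodes with out-degree `k`, i.e. with exactly `k`
internal children. -/
noncomputable def countOutDeg {m : ℕ} (k : ℕ) : MTree m → ℕ
  | MTree.lf j => if 0 < j ∧ k = 0 then 1 else 0
  | MTree.nd c =>
      (if (Finset.univ.filter (fun i => ¬ (c i = MTree.lf 0))).card = k then 1 else 0)
        + ∑ i, countOutDeg k (c i)

/-- The asymptotic density `μ_k` of nodes of out-degree `k` in a random `m`-ary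
search tree. -/
noncomputable def muDeg (m k : ℕ) : ℝ :=
  if k = 0 then ((m : ℝ) - 1) / (2 * (Hm m - 1) * ((m : ℝ) + 1))
  else 1 / ((Hm m - 1) * (m : ℝ) * ((m : ℝ) + 1))

/-- The tree obtained by adding one key to a node with `j` keys and no children. -/
def growLeaf {m : ℕ} (j : ℕ) : MTree m :=
  if j + 1 < m - 1 then MTree.lf (j + 1) else MTree.nd fun _ => MTree.lf 0

/-- The multiset of trees obtained from a tree by inserting one key, over all gaps. -/
noncomputable def succs {m : ℕ} : MTree m → Multiset (MTree m)
  | MTree.lf j => Multiset.replicate (j + 1) (growLeaf j)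
  | MTree.nd c => ∑ i, (succs (c i)).map (fun t => MTree.nd (Function.update c i t))

open Classical in
/-- The multiset of types of the internal nodes: a leaf with `j` keys has type `j - 1`,
a full node with `k` internal children has type `m - 2 + k`. -/
noncomputable def types {m : ℕ} : MTree m → Multiset ℕ
  | MTree.lf j => if j = 0 then 0 else {j - 1}
  | MTree.nd c =>
      {m - 2 + (Finset.univ.filter (fun i => ¬ (c i = MTree.lf 0))).card} + ∑ i, types (c i)

/-- Trees all of whose leaves hold at most `m - 2` keys. -/
def Valid {m : ℕ} : MTree m → Prop
  | MTree.lf j => j < m - 1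
  | MTree.nd c => ∀ i, Valid (c i)

/-- The number of gaps adjacent to a node of a given type. -/
def act (m s : ℕ) : ℕ := if s < m - 2 then s + 2 else 2 * m - 2 - s

/-- The linear statistic of a tree with weights `w` on the node types. -/
noncomputable def stat {m : ℕ} {E : Type*} [AddCommMonoid E] (w : ℕ → E) (T : MTree m) : E :=
  ((types T).map w).sum

/-- The change of the statistic with weights `w` when a key is inserted at a node of type `s`. -/
def incr {E : Type*} [AddCommGroup E] (m : ℕ) (w : ℕ → E) (s : ℕ) : E :=
  w (s + 1) - w s + if m - 2 ≤ s then w 0 else 0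

lemma sum_map_finset_sum {α ι E : Type*} [AddCommMonoid E] (s : Finset ι) (g : ι → Multiset α)
    (w : α → E) : ((∑ i ∈ s, g i).map w).sum = ∑ i ∈ s, ((g i).map w).sum := by
  classical
  induction s using Finset.induction_on with
  | empty => simp
  | insert a s ha ih => simp [Finset.sum_insert ha, ih]

section Stat
variable {m : ℕ} {E : Type*} [AddCommMonoid E]

lemma stat_lf (w : ℕ → E) (j : ℕ) :
    stat w (MTree.lf j : MTree m) = if j = 0 then 0 else w (j - 1) := by
  simp only [stat, types]; split_ifs <;> simp

open Classical in
lemma stat_nd (w : ℕ → E) (c : Fin m → MTree m) :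
    stat w (MTree.nd c) =
      w (m - 2 + (Finset.univ.filter (fun i => ¬ (c i = MTree.lf 0))).card)
        + ∑ i, stat w (c i) := by
  simp only [stat, types, Multiset.map_add, Multiset.sum_add, Multiset.map_singleton,
    Multiset.sum_singleton]
  rw [sum_map_finset_sum]

lemma stat_growLeaf (w : ℕ → E) {j : ℕ} (h : j < m - 1) :
    stat w (growLeaf j : MTree m) = w j := by
  unfold growLeaf
  split_ifs with h1
  · simp [stat_lf]
  · rw [stat_nd]
    have : j = m - 2 := by omega
    simp [stat_lf, this]

lemma growLeaf_ne (j : ℕ) : (growLeaf j : MTree m) ≠ MTree.lf 0 := by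
  unfold growLeaf; split_ifs <;> simp

lemma ne_of_mem_succs (T : MTree m) : ∀ t ∈ succs T, t ≠ MTree.lf 0 := by
  cases T with
  | lf j =>
    intro t ht
    simp only [succs] at ht
    rw [Multiset.eq_of_mem_replicate ht]; exact growLeaf_ne j
  | nd c =>
    intro t ht
    simp only [succs, Multiset.mem_sum, Multiset.mem_map] at ht
    obtain ⟨i, -, a, -, rfl⟩ := ht
    simp

lemma card_succs (T : MTree m) (h2 : 2 ≤ m) : (succs T).card = T.keys + 1 := by
  induction T with
  | lf j => simp [succs, MTree.keys]
  | nd c ih =>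
    simp only [succs, MTree.keys, Multiset.card_sum, Multiset.card_map, ih, Finset.sum_add_distrib]
    simp; omega

lemma types_lt (T : MTree m) (hT : Valid T) (h2 : 2 ≤ m) : ∀ s ∈ types T, s < 2 * m - 1 := by
  induction T with
  | lf j =>
    intro s hs
    simp only [types] at hs
    simp only [Valid] at hT
    split_ifs at hs
    · simp at hs
    · simp at hs; omega
  | nd c ih =>
    classical
    intro s hs
    simp only [types, Multiset.mem_add, Multiset.mem_singleton, Multiset.mem_sum] at hs
    rcases hs with rfl | ⟨i, -, hi⟩
    · have := Finset.card_le_univ (Finset.univ.filter (fun i => ¬ (c i = MTree.lf 0)))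
      simp at this ⊢; omega
    · exact ih i (hT i) s hi

end Stat

/-- Inserting a key in all gaps, expressed through the node types. -/
lemma sum_succs {m : ℕ} (h2 : 2 ≤ m) (w : ℕ → ℂ) (T : MTree m) (hT : Valid T)
    (h0 : T ≠ MTree.lf 0) (φ : ℂ → ℂ) :
    ((succs T).map (fun T' => φ (stat w T'))).sum =
      stat (fun s => (act m s : ℂ) * φ (stat w T + incr m w s)) T := by
  classical
  induction T generalizing φ with
  | lf j =>
    have hj : j ≠ 0 := by rintro rfl; exact h0 rfl
    simp only [Valid] at hT
    simp only [succs, Multiset.map_replicate, Multiset.sum_replicate, stat_growLeaf w hT, stat_lf,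
      hj, if_false, incr, act]
    have e1 : j - 1 + 1 = j := by omega
    rw [if_pos (by omega), if_neg (by omega), e1]
    have e2 : ((j - 1 + 2 : ℕ) : ℂ) = j + 1 := by
      rw [show j - 1 + 2 = j + 1 by omega]; push_cast; ring
    rw [e2]; simp
  | nd c ih =>
    simp only [Valid] at hT
    rw [stat_nd]
    set k := (Finset.univ.filter (fun i => ¬ (c i = MTree.lf 0))).card with hk
    set ψ := stat w (MTree.nd c) with hψ
    have hψ' : ψ = w (m - 2 + k) + ∑ i, stat w (c i) := stat_nd w c
    have key : ∀ i, (((succs (c i)).map (fun t => MTree.nd (Function.update c i t))).map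
        (fun T' => φ (stat w T'))).sum =
        (if c i = MTree.lf 0 then φ (ψ + incr m w (m - 2 + k)) else 0) +
          stat (fun s => (act m s : ℂ) * φ (ψ + incr m w s)) (c i) := by
      intro i
      rw [Multiset.map_map]
      have hsum : ∑ x, stat w (c x) = stat w (c i) + ∑ x ∈ Finset.univ.erase i, stat w (c x) :=
        (Finset.add_sum_erase _ _ (Finset.mem_univ i)).symm
      have hup : ∀ t, ∑ x, stat w (Function.update c i t x) =
          stat w t + ∑ x ∈ Finset.univ.erase i, stat w (c x) := by
        intro t
        rw [← Finset.add_sum_erase _ _ (Finset.mem_univ i)]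
        simp only [Function.update_self]
        congr 1
        refine Finset.sum_congr rfl fun x hx => ?_
        rw [Function.update_of_ne (Finset.ne_of_mem_erase hx)]
      by_cases hi : c i = MTree.lf 0
      · rw [if_pos hi, hi]
        simp only [succs, stat_lf, if_true, zero_add, Multiset.replicate_one,
          Multiset.map_singleton, Multiset.sum_singleton, Function.comp]
        have hc : (Finset.univ.filter
            (fun x => ¬ (Function.update c i (growLeaf 0) x = MTree.lf 0))).card = k + 1 := by
          have : (Finset.univ.filter
            (fun x => ¬ (Function.update c i (growLeaf 0) x = MTree.lf 0))) =
            insert i (Finset.univ.filter (fun i => ¬ (c i = MTree.lf 0))) := by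
            ext x
            by_cases hx : x = i
            · subst hx; simp [growLeaf_ne]
            · simp [hx]
          rw [this, Finset.card_insert_of_notMem (by simp [hi])]
        rw [stat_nd, hc, hup, stat_growLeaf w (by omega), hψ', hsum, hi, stat_lf, incr,
          if_pos (by omega)]
        simp only [if_true, zero_add, add_zero, Nat.le_add_right]
        congr 1; rw [← add_assoc (m - 2) k 1]; ring
      · rw [if_neg hi, zero_add]
        have hφ : ∀ t ∈ succs (c i), ((fun T' => φ (stat w T')) ∘
            fun t => MTree.nd (Function.update c i t)) t =
            (fun z => φ (z + (w (m - 2 + k) + ∑ x ∈ Finset.univ.erase i, stat w (c x))))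
              (stat w t) := by
          intro t ht
          have hc : (Finset.univ.filter
            (fun x => ¬ (Function.update c i t x = MTree.lf 0))).card = k := by
            rw [hk]; congr 1
            ext x
            by_cases hx : x = i
            · subst hx; simp [hi, ne_of_mem_succs _ t ht]
            · simp [Function.update_of_ne hx]
          simp only [Function.comp]
          rw [stat_nd, hc, hup]
          congr 1; ring
        rw [Multiset.map_congr rfl hφ, ih i (hT i) hi
          (fun z => φ (z + (w (m - 2 + k) + ∑ x ∈ Finset.univ.erase i, stat w (c x))))]
        congr 1; funext s
        congr 2
        rw [hψ', hsum]; ring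
    simp only [succs]
    rw [sum_map_finset_sum, Finset.sum_congr rfl fun i _ => key i, Finset.sum_add_distrib]
    congr 1
    rw [← Finset.sum_filter, Finset.sum_const, nsmul_eq_mul]
    congr 2
    have := Finset.card_filter_add_card_filter_not (s := (Finset.univ : Finset (Fin m)))
      (fun i => c i = MTree.lf 0)
    simp only [Finset.card_univ, Fintype.card_fin] at this
    rw [← hk] at this
    unfold act; split_ifs <;> omega

lemma stat_act {m : ℕ} (h2 : 2 ≤ m) (T : MTree m) (hT : Valid T) (h0 : T ≠ MTree.lf 0) :
    stat (fun s => (act m s : ℂ)) T = T.keys + 1 := by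
  have := sum_succs h2 (fun _ => 0) T hT h0 (fun _ => 1)
  simp only [mul_one] at this
  rw [← this]; simp [card_succs T h2, add_comm]

lemma countOutDeg_eq {m : ℕ} (h2 : 2 ≤ m) (k : ℕ) (T : MTree m) (hT : Valid T) :
    (countOutDeg k T : ℝ) =
      stat (fun s => if (if k = 0 then s ≤ m - 2 else s = m - 2 + k) then (1:ℝ) else 0) T := by
  classical
  induction T with
  | lf j =>
    simp only [Valid] at hT
    simp only [countOutDeg, stat_lf]
    split_ifs <;> first | omega | simp
  | nd c ih =>
    rw [stat_nd]
    simp only [countOutDeg]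
    push_cast
    rw [Finset.sum_congr rfl fun i _ => ih i (hT i)]
    congr 1
    split_ifs <;> first | omega | rfl

/-! ### Building trees -/

lemma build_of_lt {m : ℕ} {l : List ℕ} (h : l.length < m - 1) :
    build m l = MTree.lf l.length := by
  rw [build, dif_neg (by omega)]

lemma build_of_le {m : ℕ} {l : List ℕ} (h2 : 2 ≤ m) (h : m - 1 ≤ l.length) :
    build m l = MTree.nd (fun i =>
      build m ((l.drop (m - 1)).filter
        (fun x => (l.take (m - 1)).countP (fun p => decide (p < x)) == (i : ℕ)))) := by
  conv_lhs => rw [build]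
  rw [dif_pos ⟨h2, h⟩]

lemma length_child_lt {m : ℕ} {l : List ℕ} (h2 : 2 ≤ m) (h : m - 1 ≤ l.length) (f : ℕ → Bool) :
    ((l.drop (m - 1)).filter f).length < l.length :=
  lt_of_le_of_lt (List.length_filter_le _ _) (by rw [List.length_drop]; omega)

lemma countP_take_lt {m : ℕ} (l : List ℕ) (f : ℕ → Bool) (h2 : 2 ≤ m) :
    (l.take (m - 1)).countP f < m := by
  have h1 : (l.take (m - 1)).countP f ≤ (l.take (m - 1)).length := List.countP_le_length
  have h3 := List.length_take_le (m - 1) l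
  omega

lemma valid_build {m : ℕ} (h2 : 2 ≤ m) (l : List ℕ) : Valid (build m l) := by
  induction hn : l.length using Nat.strong_induction_on generalizing l with
  | _ n ih =>
    by_cases h : l.length < m - 1
    · rw [build_of_lt h]; exact h
    · rw [build_of_le h2 (by omega)]
      intro i
      exact ih _ (hn ▸ length_child_lt h2 (by omega) _) _ rfl

lemma sum_length_filter {m : ℕ} (L : List ℕ) (f : ℕ → ℕ) (hf : ∀ x ∈ L, f x < m) :
    ∑ i : Fin m, (L.filter (fun x => f x == (i : ℕ))).length = L.length := by
  induction L with
  | nil => simp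
  | cons a L ih =>
    have ha := hf a (by simp)
    have : ∀ i : Fin m, ((a :: L).filter (fun x => f x == (i : ℕ))).length =
        (L.filter (fun x => f x == (i : ℕ))).length + if i = ⟨f a, ha⟩ then 1 else 0 := by
      intro i
      by_cases hi : f a = i
      · rw [List.filter_cons_of_pos (by simpa using hi), if_pos (Fin.ext hi.symm)]; rfl
      · rw [List.filter_cons_of_neg (by simpa using hi), if_neg
          (fun h => hi (by rw [h]))]; rfl
    simp only [this, Finset.sum_add_distrib, ih fun x hx => hf x (by simp [hx])]
    simp

lemma keys_build {m : ℕ} (h2 : 2 ≤ m) (l : List ℕ) : (build m l).keys = l.length := by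
  induction hn : l.length using Nat.strong_induction_on generalizing l with
  | _ n ih =>
    by_cases h : l.length < m - 1
    · rw [build_of_lt h]; exact hn
    · rw [build_of_le h2 (by omega)]
      simp only [MTree.keys]
      rw [Finset.sum_congr rfl fun i _ => ih _ (hn ▸ length_child_lt h2 (by omega) _) _ rfl,
        sum_length_filter _ _ fun x _ => countP_take_lt l _ h2, List.length_drop]
      omega

lemma build_map {m : ℕ} (h2 : 2 ≤ m) (φ : ℕ → ℕ) (l : List ℕ)
    (hφ : ∀ x ∈ l, ∀ y ∈ l, (φ x < φ y ↔ x < y)) : build m (l.map φ) = build m l := by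
  induction hn : l.length using Nat.strong_induction_on generalizing l with
  | _ n ih =>
    by_cases h : l.length < m - 1
    · rw [build_of_lt h, build_of_lt (by simpa using h)]; simp
    · rw [build_of_le (l := l) h2 (by omega),
        build_of_le (l := l.map φ) h2 (by rw [List.length_map]; omega)]
      congr 1; funext i
      rw [← List.map_drop, ← List.map_take, List.filter_map]
      have : (List.drop (m - 1) l).filter ((fun x => List.countP (fun p => decide (p < x))
          (List.map φ (List.take (m - 1) l)) == (i:ℕ)) ∘ φ) =
          (List.drop (m - 1) l).filter (fun x => (l.take (m - 1)).countP
            (fun p => decide (p < x)) == (i : ℕ)) := by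
        refine List.filter_congr fun x hx => ?_
        simp only [Function.comp, List.countP_map]
        congr 1
        refine List.countP_congr fun y hy => ?_
        simp [hφ y (List.mem_of_mem_take hy) x (List.mem_of_mem_drop hx)]
      rw [this]
      refine ih _ (hn ▸ length_child_lt h2 (by omega) _) _ ?_ rfl
      intro x hx y hy
      exact hφ x (List.mem_of_mem_drop (List.mem_of_mem_filter hx)) y
        (List.mem_of_mem_drop (List.mem_of_mem_filter hy))

lemma countP_lt_of_mem {l : List ℕ} {x y z : ℕ} (hz : z ∈ l) (h1 : x ≤ z) (h2 : z < y) :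
    l.countP (fun p => decide (p < x)) < l.countP (fun p => decide (p < y)) := by
  induction l with
  | nil => simp at hz
  | cons a l ih =>
    have hmono : l.countP (fun p => decide (p < x)) ≤ l.countP (fun p => decide (p < y)) :=
      List.countP_mono_left (by intro p _ hp; simp at hp ⊢; omega)
    simp only [List.countP_cons, decide_eq_true_eq]
    rcases List.mem_cons.1 hz with rfl | hz
    · rw [if_neg (by omega), if_pos h2]; omega
    · have := ih hz
      split_ifs <;> omega

lemma countP_mono_lt {l : List ℕ} {x y : ℕ} (h : x ≤ y) :
    l.countP (fun p => decide (p < x)) ≤ l.countP (fun p => decide (p < y)) :=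
  List.countP_mono_left (by intro p _ hp; simp at hp ⊢; omega)

lemma card_le_of_separated {l : List ℕ} {X : Finset ℕ}
    (hX : ∀ x ∈ X, ∀ y ∈ X, x < y → ∃ z ∈ l, x < z ∧ z < y) : X.card ≤ l.length + 1 := by
  rw [← Finset.card_range (l.length + 1)]
  refine Finset.card_le_card_of_injOn (fun x => l.countP (fun p => decide (p < x))) ?_ ?_
  · intro x _
    have : l.countP (fun p => decide (p < x)) ≤ l.length := List.countP_le_length
    simp; omega
  · intro x hx y hy hxy
    rcases lt_trichotomy x y with h | h | h
    · obtain ⟨z, hz, h1, h2⟩ := hX x hx y hy h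
      have := countP_lt_of_mem hz h1.le h2
      simp at hxy; omega
    · exact h
    · obtain ⟨z, hz, h1, h2⟩ := hX y hy x hx h
      have := countP_lt_of_mem hz h1.le h2
      simp at hxy; omega

/-- If `X` has exactly one element in each gap of `l`, appending the elements of `X` to `l`
produces all one-key insertions in the tree built from `l`. -/
lemma sum_build_append {m : ℕ} (h2 : 2 ≤ m) (l : List ℕ) (X : Finset ℕ)
    (hc : X.card = l.length + 1)
    (hX : ∀ x ∈ X, ∀ y ∈ X, x < y → ∃ z ∈ l, x < z ∧ z < y) :
    ∑ x ∈ X, ({build m (l ++ [x])} : Multiset (MTree m)) = succs (build m l) := by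
  induction hn : l.length using Nat.strong_induction_on generalizing l X with
  | _ n ih =>
    by_cases h : l.length < m - 1
    · rw [build_of_lt h]
      have : ∀ x, build m (l ++ [x]) = growLeaf l.length := by
        intro x
        unfold growLeaf
        split_ifs with h'
        · rw [build_of_lt (by simpa using h')]; simp
        · rw [build_of_le h2 (by simp; omega)]
          congr 1; funext i
          rw [List.drop_eq_nil_of_le (by simp; omega)]
          rw [List.filter_nil, build_of_lt (by simp; omega)]; rfl
      simp only [this, succs, Finset.sum_const, hc]
      rw [Multiset.nsmul_singleton]
    · have hle : m - 1 ≤ l.length := by omega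
      set R := l.take (m - 1) with hR
      set cnt : ℕ → ℕ := fun x => R.countP (fun p => decide (p < x)) with hcnt
      have hcl : ∀ x, cnt x < m := fun x => countP_take_lt l _ h2
      set ch : Fin m → List ℕ := fun i => (l.drop (m - 1)).filter (fun x => cnt x == (i : ℕ))
        with hch
      have hb : build m l = MTree.nd (fun i => build m (ch i)) := build_of_le h2 hle
      have hb' : ∀ i : Fin m, ∀ x, cnt x = i → build m (l ++ [x]) =
          MTree.nd (Function.update (fun i => build m (ch i)) i (build m (ch i ++ [x]))) := by
        intro i x hx
        rw [build_of_le h2 (by simp; omega), List.take_append_of_le_length hle,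
          List.drop_append_of_le_length hle]
        congr 1; funext k
        rw [List.filter_append]
        by_cases hk : k = i
        · subst hk
          rw [Function.update_self, List.filter_singleton]
          simp only [← hR]
          rw [show (R.countP (fun p => decide (p < x)) == (k : ℕ)) = true by simpa using hx]
          rfl
        · rw [Function.update_of_ne hk, List.filter_singleton]
          simp only [← hR]
          rw [show (R.countP (fun p => decide (p < x)) == (k : ℕ)) = false by
            rw [beq_eq_false_iff_ne]; intro h'; exact hk (Fin.ext (h'.symm.trans hx)),
            cond_false, List.append_nil]
      have hsep : ∀ i : Fin m, ∀ x ∈ X.filter (fun x => cnt x = i),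
          ∀ y ∈ X.filter (fun x => cnt x = i), x < y → ∃ z ∈ ch i, x < z ∧ z < y := by
        intro i x hx y hy hxy
        simp only [Finset.mem_filter] at hx hy
        obtain ⟨z, hz, h3, h4⟩ := hX x hx.1 y hy.1 hxy
        refine ⟨z, ?_, h3, h4⟩
        have hzl : z ∈ R ++ l.drop (m - 1) := by rw [hR, List.take_append_drop]; exact hz
        have hm1 : cnt x ≤ cnt z := countP_mono_lt h3.le
        have hm2 : cnt z ≤ cnt y := countP_mono_lt h4.le
        rcases List.mem_append.1 hzl with h5 | h5
        · have : cnt x < cnt y := countP_lt_of_mem h5 h3.le h4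
          omega
        · rw [hch]; simp only [List.mem_filter, beq_iff_eq]
          exact ⟨h5, by omega⟩
      have hcard_le : ∀ i ∈ (Finset.univ : Finset (Fin m)),
          (X.filter (fun x => cnt x = i)).card ≤ (ch i).length + 1 :=
        fun i _ => card_le_of_separated (hsep i)
      have hfib : ∀ {M : Type} [AddCommMonoid M] (f : ℕ → M),
          ∑ x ∈ X, f x = ∑ i : Fin m, ∑ x ∈ X.filter (fun x => cnt x = i), f x := by
        intro M _ f
        rw [← Finset.sum_fiberwise X (fun x => (⟨cnt x, hcl x⟩ : Fin m)) f]
        refine Finset.sum_congr rfl fun i _ => ?_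
        congr 1
        refine Finset.filter_congr fun x _ => ?_
        rw [Fin.ext_iff]
      have hcard_sum : ∑ i : Fin m, (X.filter (fun x => cnt x = i)).card =
          ∑ i : Fin m, ((ch i).length + 1) := by
        have h1 := hfib (fun _ => (1 : ℕ))
        simp only [Finset.sum_const, smul_eq_mul, mul_one] at h1
        rw [← h1, Finset.sum_add_distrib, sum_length_filter _ _ fun x _ => hcl x,
          List.length_drop]
        simp; omega
      have hcard := (Finset.sum_eq_sum_iff_of_le hcard_le).1 hcard_sum
      rw [hfib, hb]
      simp only [succs]
      refine Finset.sum_congr rfl fun i hi => ?_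
      rw [← ih _ (hn ▸ length_child_lt h2 hle _) (ch i) _ (hcard i hi) (hsep i) rfl]
      rw [← Multiset.coe_mapAddMonoidHom, map_sum]
      refine Finset.sum_congr rfl fun x hx => ?_
      rw [hb' i x (Finset.mem_filter.1 hx).2]
      simp

/-! ### The uniform model as a Markov chain -/

/-- The average of a functional of the tree over all permutations. -/
noncomputable def avg (m n : ℕ) {E : Type*} [NormedAddCommGroup E] [NormedSpace ℝ E]
    (f : MTree m → E) : E :=
  ((Nat.factorial n : ℝ)⁻¹) • ∑ π : Equiv.Perm (Fin n), f (mst m n π)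

/-- The permutation of `Fin (n + 1)` with last value `r` and the other values ordered
as prescribed by `σ`. -/
def extendPerm {n : ℕ} (r : Fin (n + 1)) (σ : Equiv.Perm (Fin n)) : Equiv.Perm (Fin (n + 1)) :=
  finSuccEquivLast.trans ((Equiv.optionCongr σ).trans (finSuccEquiv' r).symm)

lemma extendPerm_last {n : ℕ} (r : Fin (n + 1)) (σ : Equiv.Perm (Fin n)) :
    extendPerm r σ (Fin.last n) = r := by
  simp [extendPerm]

lemma extendPerm_castSucc {n : ℕ} (r : Fin (n + 1)) (σ : Equiv.Perm (Fin n)) (i : Fin n) :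
    extendPerm r σ i.castSucc = r.succAbove (σ i) := by
  simp [extendPerm]

lemma extendPerm_bijective (n : ℕ) :
    Function.Bijective (fun p : Equiv.Perm (Fin n) × Fin (n + 1) => extendPerm p.2 p.1) := by
  rw [Fintype.bijective_iff_injective_and_card]
  constructor
  · rintro ⟨σ, r⟩ ⟨τ, s⟩ h
    have h1 : r = s := by
      have := congrArg (fun e => e (Fin.last n)) h
      simpa [extendPerm_last] using this
    subst h1
    congr 1
    ext i
    have := congrArg (fun e => e i.castSucc) h
    simp only [extendPerm_castSucc] at this
    rw [Fin.succAbove_right_injective this]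
  · simp [Fintype.card_perm, Nat.factorial_succ, mul_comm]

lemma mst_extendPerm {m n : ℕ} (h2 : 2 ≤ m) (r : Fin (n + 1)) (σ : Equiv.Perm (Fin n)) :
    mst m (n + 1) (extendPerm r σ) =
      build m (((List.finRange n).map (fun i => 2 * (σ i : ℕ) + 1)) ++ [2 * (r : ℕ)]) := by
  unfold mst
  rw [List.finRange_succ_last, List.map_append, List.map_map]
  set φ : ℕ → ℕ := fun v => if v < r then 2 * v + 1 else if v = r then 2 * r else 2 * v - 1 with hφ
  rw [← build_map h2 φ]
  · congr 1
    rw [List.map_append, List.map_map]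
    congr 1
    · refine List.map_congr_left fun i _ => ?_
      simp only [Function.comp, extendPerm_castSucc, hφ, Fin.succAbove, Fin.lt_def]
      split_ifs <;> simp_all <;> omega
    · simp [extendPerm_last, hφ]
  · intro x _ y _
    simp only [hφ]
    split_ifs <;> omega

lemma sum_mst_extendPerm {m n : ℕ} (h2 : 2 ≤ m) {E : Type*} [AddCommMonoid E]
    (f : MTree m → E) (σ : Equiv.Perm (Fin n)) :
    ∑ r : Fin (n + 1), f (mst m (n + 1) (extendPerm r σ)) = ((succs (mst m n σ)).map f).sum := by
  set l := (List.finRange n).map (fun i => 2 * (σ i : ℕ) + 1) with hl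
  have hb : build m l = mst m n σ := by
    rw [mst, ← build_map h2 (fun v => 2 * v + 1) ((List.finRange n).map fun i => (σ i : ℕ)),
      List.map_map]
    · rfl
    · intro x _ y _; simp
  have hinj : Function.Injective (fun r : ℕ => 2 * r) := fun a b h => by simpa using h
  have key := sum_build_append h2 l ((Finset.range (n + 1)).map ⟨_, hinj⟩) (by simp [hl]) (by
    intro x hx y hy hxy
    simp only [Finset.mem_map, Finset.mem_range, Function.Embedding.coeFn_mk] at hx hy
    obtain ⟨a, ha, rfl⟩ := hx
    obtain ⟨b, hb, rfl⟩ := hy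
    refine ⟨2 * a + 1, ?_, by omega, by omega⟩
    simp only [hl, List.mem_map, List.mem_finRange, true_and]
    exact ⟨σ.symm ⟨a, by omega⟩, by simp⟩)
  rw [← hb, ← key, sum_map_finset_sum, Finset.sum_map, Finset.sum_range]
  refine Finset.sum_congr rfl fun r _ => ?_
  rw [mst_extendPerm h2]; simp [hl]

lemma avg_succ {m : ℕ} (h2 : 2 ≤ m) (n : ℕ) {E : Type*} [NormedAddCommGroup E] [NormedSpace ℝ E]
    (f : MTree m → E) :
    avg m (n + 1) f = avg m n (fun T => ((n : ℝ) + 1)⁻¹ • ((succs T).map f).sum) := by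
  unfold avg
  rw [← (extendPerm_bijective n).sum_comp (fun π => f (mst m (n + 1) π)), Fintype.sum_prod_type]
  simp only [sum_mst_extendPerm h2, ← Finset.smul_sum, smul_smul]
  congr 1
  rw [Nat.factorial_succ]; push_cast; rw [mul_inv, mul_comm]

section Avg
variable {m n : ℕ} {E : Type*} [NormedAddCommGroup E] [NormedSpace ℝ E]

lemma avg_congr {f g : MTree m → E} (h : ∀ π, f (mst m n π) = g (mst m n π)) :
    avg m n f = avg m n g := by
  unfold avg; simp only [h]

lemma avg_add (f g : MTree m → E) :
    avg m n (fun T => f T + g T) = avg m n f + avg m n g := by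
  simp [avg, Finset.sum_add_distrib]

lemma avg_sub (f g : MTree m → E) :
    avg m n (fun T => f T - g T) = avg m n f - avg m n g := by
  simp [avg, Finset.sum_sub_distrib, smul_sub]

lemma avg_finset_sum {ι : Type*} (s : Finset ι) (f : ι → MTree m → E) :
    avg m n (fun T => ∑ i ∈ s, f i T) = ∑ i ∈ s, avg m n (f i) := by
  simp only [avg]; rw [Finset.sum_comm, Finset.smul_sum]

lemma avg_const_mul {A : Type*} [NormedRing A] [NormedAlgebra ℝ A] (c : A) (f : MTree m → A) :
    avg m n (fun T => c * f T) = c * avg m n f := by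
  simp only [avg]; rw [← Finset.mul_sum, mul_smul_comm]

lemma avg_const (c : E) : avg m n (fun _ => c) = c := by
  simp only [avg, Finset.sum_const, Finset.card_univ, Fintype.card_perm, Fintype.card_fin]
  rw [← Nat.cast_smul_eq_nsmul ℝ, smul_smul, inv_mul_cancel₀ (by positivity), one_smul]

lemma avg_mono {f g : MTree m → ℝ} (h : ∀ π, f (mst m n π) ≤ g (mst m n π)) :
    avg m n f ≤ avg m n g := by
  unfold avg
  exact smul_le_smul_of_nonneg_left (Finset.sum_le_sum fun π _ => h π) (by positivity)

lemma avg_nonneg {f : MTree m → ℝ} (h : ∀ π, 0 ≤ f (mst m n π)) : 0 ≤ avg m n f := by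
  have := avg_mono (n := n) (f := fun _ => 0) h
  rwa [avg_const] at this

lemma norm_avg_le (f : MTree m → E) : ‖avg m n f‖ ≤ avg m n (fun T => ‖f T‖) := by
  unfold avg
  rw [norm_smul, smul_eq_mul, Real.norm_of_nonneg (by positivity)]
  gcongr
  exact norm_sum_le _ _

lemma avg_abs_le_sqrt (f : MTree m → ℝ) :
    avg m n (fun T => |f T|) ≤ Real.sqrt (avg m n (fun T => f T ^ 2)) := by
  apply Real.le_sqrt_of_sq_le
  have h : 0 ≤ avg m n (fun T => (|f T| - avg m n (fun T => |f T|)) ^ 2) :=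
    avg_nonneg fun _ => sq_nonneg _
  set a := avg m n (fun T => |f T|) with ha
  have h1 : avg m n (fun T => (|f T| - a) ^ 2) = avg m n (fun T => f T ^ 2) - a ^ 2 := by
    have : (fun T : MTree m => (|f T| - a) ^ 2) =
        fun T => (f T ^ 2 - (2 * a) * |f T|) + a ^ 2 := by
      funext T; rw [sub_sq, sq_abs]; ring
    rw [this, avg_add, avg_sub, avg_const_mul, avg_const, ← ha]; ring
  linarith

end Avg

lemma valid_mst {m n : ℕ} (h2 : 2 ≤ m) (π : Equiv.Perm (Fin n)) : Valid (mst m n π) :=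
  valid_build h2 _

lemma keys_mst {m n : ℕ} (h2 : 2 ≤ m) (π : Equiv.Perm (Fin n)) : (mst m n π).keys = n := by
  rw [mst, keys_build h2]; simp

lemma mst_ne {m n : ℕ} (h2 : 2 ≤ m) (hn : n ≠ 0) (π : Equiv.Perm (Fin n)) :
    mst m n π ≠ MTree.lf 0 := by
  intro h
  have := keys_mst h2 π
  rw [h] at this; exact hn this.symm

lemma avg_succ_stat {m n : ℕ} (h2 : 2 ≤ m) (hn : n ≠ 0) (w : ℕ → ℂ) (φ : ℂ → ℂ) :
    avg m (n + 1) (fun T => φ (stat w T)) = avg m n (fun T => ((n : ℂ) + 1)⁻¹ *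
      stat (fun s => (act m s : ℂ) * φ (stat w T + incr m w s)) T) := by
  rw [avg_succ h2]
  refine avg_congr fun π => ?_
  rw [sum_succs h2 w _ (valid_mst h2 π) (mst_ne h2 hn π), Complex.real_smul]
  push_cast; rfl

/-! ### Location of the characteristic roots -/

lemma arctan_step {S r t s k : ℝ} (h : S ≤ Real.arctan r + k * Real.pi) (h1 : r * t < 1)
    (h2 : (r + t) / (1 - r * t) ≤ s) : S + Real.arctan t ≤ Real.arctan s + k * Real.pi := by
  have := Real.arctan_add h1
  have h3 := Real.arctan_mono h2
  linarith

lemma arctan_step_pi {S r t s k : ℝ} (h : S ≤ Real.arctan r + k * Real.pi)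
    (h1 : 0 < r ∧ 1 < r * t) (h2 : (r + t) / (1 - r * t) ≤ s) :
    S + Real.arctan t ≤ Real.arctan s + (k + 1) * Real.pi := by
  have := Real.arctan_add_eq_add_pi h1.2 h1.1
  have h3 := Real.arctan_mono h2
  linarith

lemma sum_arctan_lt :
    ∑ j ∈ Finset.range 25, Real.arctan ((4409 / 2000 : ℝ) / (j + 3 / 2)) < 2 * Real.pi := by
  have h : Real.arctan (4409 / 3000) ≤ Real.arctan (4409 / 3000) + 0 * Real.pi := by simp
  replace h := arctan_step_pi h (t := 4409/5000) (s := -794543/100000) (by norm_num) (by norm_num)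
  replace h := arctan_step h (t := 4409/7000) (s := -1218351/1000000) (by norm_num) (by norm_num)
  replace h := arctan_step h (t := 4409/9000) (s := -91237/200000) (by norm_num) (by norm_num)
  replace h := arctan_step h (t := 4409/11000) (s := -5851/125000) (by norm_num) (by norm_num)
  replace h := arctan_step h (t := 4409/13000) (s := 143889/500000) (by norm_num) (by norm_num)
  replace h := arctan_step h (t := 4409/15000) (s := 79433/125000) (by norm_num) (by norm_num)
  replace h := arctan_step h (t := 4409/17000) (s := 1071393/1000000) (by norm_num) (by norm_num)
  replace h := arctan_step h (t := 4409/19000) (s := 346947/200000) (by norm_num) (by norm_num)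
  replace h := arctan_step h (t := 4409/21000) (s := 3058703/1000000) (by norm_num) (by norm_num)
  replace h := arctan_step h (t := 4409/23000) (s := 7857659/1000000) (by norm_num) (by norm_num)
  replace h := arctan_step_pi h (t := 4409/25000) (s := -10412783/500000) (by norm_num) (by norm_num)
  replace h := arctan_step h (t := 4409/27000) (s := -4695183/1000000) (by norm_num) (by norm_num)
  replace h := arctan_step h (t := 4409/29000) (s := -21207/8000) (by norm_num) (by norm_num)
  replace h := arctan_step h (t := 4409/31000) (s := -56931/31250) (by norm_num) (by norm_num)
  replace h := arctan_step h (t := 4409/33000) (s := -678857/500000) (by norm_num) (by norm_num)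
  replace h := arctan_step h (t := 4409/35000) (s := -525921/500000) (by norm_num) (by norm_num)
  replace h := arctan_step h (t := 4409/37000) (s := -414399/500000) (by norm_num) (by norm_num)
  replace h := arctan_step h (t := 4409/39000) (s := -163607/250000) (by norm_num) (by norm_num)
  replace h := arctan_step h (t := 4409/41000) (s := -255467/500000) (by norm_num) (by norm_num)
  replace h := arctan_step h (t := 4409/43000) (s := -97017/250000) (by norm_num) (by norm_num)
  replace h := arctan_step h (t := 4409/45000) (s := -34933/125000) (by norm_num) (by norm_num)
  replace h := arctan_step h (t := 4409/47000) (s := -11307/62500) (by norm_num) (by norm_num)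
  replace h := arctan_step h (t := 4409/49000) (s := -3579/40000) (by norm_num) (by norm_num)
  replace h := arctan_step h (t := 4409/51000) (s := -3/1000) (by norm_num) (by norm_num)
  have h0 : 0 < Real.arctan (3 / 1000) := Real.arctan_pos.2 (by norm_num)
  simp only [Finset.sum_range_succ, Finset.sum_range_zero]
  norm_num at h ⊢
  linarith

lemma prod_ge_factorial_sq {m : ℕ} (h2 : 2 ≤ m) (h26 : m ≤ 26) :
    ((Nat.factorial m : ℝ)) ^ 2 ≤
      ∏ j ∈ Finset.range (m - 1), (((j : ℝ) + 3 / 2) ^ 2 + (4409 / 2000) ^ 2) := by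
  interval_cases m <;> norm_num [Finset.prod_range_succ, Nat.factorial]

lemma factorial_eq_prod {m : ℕ} (h2 : 2 ≤ m) :
    (Nat.factorial m : ℝ) = ∏ j ∈ Finset.range (m - 1), ((1 : ℝ) + (j + 1)) := by
  obtain ⟨n, rfl⟩ : ∃ n, m = n + 1 := ⟨m - 1, by omega⟩
  clear h2
  simp only [Nat.add_sub_cancel]
  induction n with
  | zero => simp
  | succ n ih =>
    rw [Finset.prod_range_succ, ← ih, Nat.factorial_succ]; push_cast; ring

lemma arg_eq_arctan {z : ℂ} (h : 0 < z.re) : z.arg = Real.arctan (z.im / z.re) := by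
  have h1 : |z.arg| < Real.pi / 2 := Complex.abs_arg_lt_pi_div_two_iff.2 (Or.inl h)
  rw [abs_lt] at h1
  rw [← Complex.tan_arg, Real.arctan_tan h1.1 h1.2]

lemma re_lt_half_of_im_nonneg {m : ℕ} (h2 : 2 ≤ m) (h26 : m ≤ 26) {z : ℂ}
    (hz : ∏ j ∈ Finset.range (m - 1), (z + (j + 1)) = Nat.factorial m) (h1 : z ≠ 1)
    (him : 0 ≤ z.im) : z.re < 1 / 2 := by
  by_contra hre
  push Not at hre
  have hmem : 0 ∈ Finset.range (m - 1) := by simp; omega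
  have hsq : ∏ j ∈ Finset.range (m - 1), ((z.re + (j + 1)) ^ 2 + z.im ^ 2) =
      (Nat.factorial m : ℝ) ^ 2 := by
    have := congrArg Complex.normSq hz
    rw [map_prod, Complex.normSq_natCast] at this
    rw [sq (Nat.factorial m : ℝ), ← this]
    refine Finset.prod_congr rfl fun j _ => ?_
    rw [Complex.normSq_apply]; simp; ring
  have hy : z.im ≤ 4409 / 2000 := by
    by_contra hy
    push Not at hy
    have h3 : ∏ j ∈ Finset.range (m - 1), (((j : ℝ) + 3 / 2) ^ 2 + (4409 / 2000) ^ 2) <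
        ∏ j ∈ Finset.range (m - 1), ((z.re + (j + 1)) ^ 2 + z.im ^ 2) := by
      refine Finset.prod_lt_prod_of_nonempty (fun j _ => by positivity) (fun j _ => ?_) ⟨0, hmem⟩
      have : ((j : ℝ) + 3 / 2) ≤ z.re + (j + 1) := by linarith
      have h5 : (4409 / 2000 : ℝ) ^ 2 < z.im ^ 2 := by gcongr
      have h6 : ((j : ℝ) + 3 / 2) ^ 2 ≤ (z.re + (j + 1)) ^ 2 := by gcongr
      linarith
    have := prod_ge_factorial_sq h2 h26
    linarith
  have hpos : ∀ j : ℕ, 0 < (z + (j + 1)).re := by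
    intro j; simp; positivity
  set θ : ℕ → ℝ := fun j => (z + (j + 1)).arg with hθ
  have hθ' : ∀ j, θ j = Real.arctan (z.im / (z.re + (j + 1))) := by
    intro j; rw [hθ]; simp only []; rw [arg_eq_arctan (hpos j)]; simp
  have hθ0 : ∀ j, 0 ≤ θ j := by
    intro j; rw [hθ']; exact Real.arctan_nonneg.2 (by positivity)
  have hsum : ∑ j ∈ Finset.range (m - 1), θ j < 2 * Real.pi := by
    refine lt_of_le_of_lt ?_ sum_arctan_lt
    refine le_trans (Finset.sum_le_sum_of_subset_of_nonneg
      (Finset.range_mono (show m - 1 ≤ 25 by omega)) fun j _ _ => hθ0 j) ?_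
    refine Finset.sum_le_sum fun j _ => ?_
    rw [hθ']
    apply Real.arctan_mono
    have : ((j : ℝ) + 3 / 2) ≤ z.re + (j + 1) := by linarith
    gcongr
  have hexp : Complex.exp ((∑ j ∈ Finset.range (m - 1), θ j : ℝ) * Complex.I) = 1 := by
    have h3 : (∏ j ∈ Finset.range (m - 1), (‖z + (j + 1)‖ : ℂ)) = Nat.factorial m := by
      have := congrArg (fun x : ℂ => (‖x‖ : ℂ)) hz
      simpa using this
    have h4 : ∏ j ∈ Finset.range (m - 1), (z + (j + 1)) =
        (∏ j ∈ Finset.range (m - 1), (‖z + (j + 1)‖ : ℂ)) *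
          Complex.exp ((∑ j ∈ Finset.range (m - 1), θ j : ℝ) * Complex.I) := by
      push_cast
      rw [Finset.sum_mul, Complex.exp_sum, ← Finset.prod_mul_distrib]
      refine Finset.prod_congr rfl fun j _ => ?_
      exact (Complex.norm_mul_exp_arg_mul_I _).symm
    rw [h3, hz] at h4
    have h5 : (Nat.factorial m : ℂ) ≠ 0 := by exact_mod_cast Nat.factorial_ne_zero m
    field_simp at h4
    exact h4.symm
  have hzero : ∑ j ∈ Finset.range (m - 1), θ j = 0 := by
    obtain ⟨k, hk⟩ := Complex.exp_eq_one_iff.1 hexp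
    have hk' : ∑ j ∈ Finset.range (m - 1), θ j = k * (2 * Real.pi) := by
      have := congrArg Complex.im hk
      simpa using this
    have hnn : 0 ≤ ∑ j ∈ Finset.range (m - 1), θ j := Finset.sum_nonneg fun j _ => hθ0 j
    have hpi := Real.pi_pos
    have hk0 : k = 0 := by
      have h6 : (k : ℝ) < 1 := by
        by_contra hc
        push Not at hc
        nlinarith
      have h7 : (-1 : ℝ) < k := by
        by_contra hc
        push Not at hc
        nlinarith
      have h6' : k < 1 := by exact_mod_cast h6
      have h7' : -1 < k := by exact_mod_cast h7
      omega
    rw [hk', hk0]; simp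
  have hθz : θ 0 = 0 := (Finset.sum_eq_zero_iff_of_nonneg fun j _ => hθ0 j).1 hzero 0 hmem
  have him0 : z.im = 0 := by
    rw [hθ', Real.arctan_eq_zero_iff] at hθz
    simp only [Nat.cast_zero, zero_add, div_eq_zero_iff] at hθz
    rcases hθz with h | h
    · exact h
    · linarith
  have hreal : ∏ j ∈ Finset.range (m - 1), (z.re + (j + 1)) =
      ∏ j ∈ Finset.range (m - 1), ((1 : ℝ) + (j + 1)) := by
    rw [← factorial_eq_prod h2]
    have hzr : z = (z.re : ℂ) := by apply Complex.ext <;> simp [him0]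
    rw [hzr] at hz
    exact_mod_cast hz
  rcases lt_trichotomy z.re 1 with h | h | h
  · have := Finset.prod_lt_prod_of_nonempty (s := Finset.range (m - 1))
      (f := fun j : ℕ => z.re + (j + 1)) (g := fun j : ℕ => (1 : ℝ) + (j + 1))
      (fun j _ => by positivity) (fun j _ => by linarith) ⟨0, hmem⟩
    linarith
  · exact h1 (Complex.ext h him0)
  · have := Finset.prod_lt_prod_of_nonempty (s := Finset.range (m - 1))
      (g := fun j : ℕ => z.re + (j + 1)) (f := fun j : ℕ => (1 : ℝ) + (j + 1))
      (fun j _ => by positivity) (fun j _ => by linarith) ⟨0, hmem⟩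
    linarith

/-- For `m ≤ 26` the characteristic roots other than `1` have real part less than `1 / 2`. -/
lemma re_lt_half {m : ℕ} (h2 : 2 ≤ m) (h26 : m ≤ 26) {z : ℂ}
    (hz : ∏ j ∈ Finset.range (m - 1), (z + (j + 1)) = Nat.factorial m) (h1 : z ≠ 1) :
    z.re < 1 / 2 := by
  rcases le_total 0 z.im with h | h
  · exact re_lt_half_of_im_nonneg h2 h26 hz h1 h
  · have := re_lt_half_of_im_nonneg h2 h26 (z := (starRingEnd ℂ) z) ?_ ?_ (by simpa using h)
    · simpa using this
    · have := congrArg (starRingEnd ℂ) hz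
      simpa [map_prod] using this
    · intro h'
      apply h1
      have := congrArg (starRingEnd ℂ) h'
      simpa using this

lemma prod_abs_sub_le (n : ℕ) (t : ℝ) (h0 : 0 ≤ t) (h1 : t ≤ n + 1) :
    ∏ j ∈ Finset.range n, |-t + (j + 1)| ≤ Nat.factorial n := by
  induction n generalizing t with
  | zero => simp
  | succ n ih =>
    push_cast at h1
    by_cases ht : t ≤ n + 1
    · rw [Finset.prod_range_succ, Nat.factorial_succ, mul_comm (n + 1)]
      push_cast
      refine mul_le_mul (ih t h0 ht) ?_ (abs_nonneg _) (by positivity)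
      rw [abs_le]; constructor <;> linarith
    · push Not at ht
      have h3 : ∀ n : ℕ, ∏ j ∈ Finset.range n, ((n : ℝ) - j) = Nat.factorial n := by
        intro n
        induction n with
        | zero => simp
        | succ n ih =>
          rw [Finset.prod_range_succ', Nat.factorial_succ]; push_cast; rw [← ih, mul_comm]
          simp
      rw [← h3]
      refine Finset.prod_le_prod (fun j _ => abs_nonneg _) fun j hj => ?_
      have hj' : (j : ℝ) + 1 ≤ n + 1 := by
        have := Finset.mem_range.1 hj
        have : j ≤ n := by omega
        have : (j : ℝ) ≤ n := by exact_mod_cast this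
        linarith
      rw [abs_le]; push_cast; constructor <;> linarith

lemma not_root_of_neg {m : ℕ} (h2 : 2 ≤ m) (t : ℝ) (h0 : 0 ≤ t) (h1 : t ≤ m) :
    ∏ j ∈ Finset.range (m - 1), (-(t : ℂ) + (j + 1)) ≠ Nat.factorial m := by
  intro h
  have h3 := congrArg (fun x : ℂ => ‖x‖) h
  simp only [norm_prod, Complex.norm_natCast] at h3
  have h4 := prod_abs_sub_le (m - 1) t h0 (by
    rw [Nat.cast_sub (by omega)]; push_cast; linarith)
  have h5 : ∏ j ∈ Finset.range (m - 1), ‖-(t : ℂ) + (j + 1)‖ =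
      ∏ j ∈ Finset.range (m - 1), |-t + (j + 1)| := by
    refine Finset.prod_congr rfl fun j _ => ?_
    rw [← Real.norm_eq_abs, ← Complex.norm_real]; push_cast; rfl
  rw [h5] at h3
  rw [h3] at h4
  have : Nat.factorial (m - 1) < Nat.factorial m := Nat.factorial_lt (by omega) |>.2 (by omega)
  have : (Nat.factorial (m - 1) : ℝ) < Nat.factorial m := by exact_mod_cast this
  linarith

open Polynomial in
/-- The characteristic polynomial of the leaf types. -/
noncomputable def charPol (m : ℕ) : ℂ[X] :=
  ∏ j ∈ Finset.range (m - 1), (X + C ((j : ℂ) + 1)) - C (Nat.factorial m : ℂ)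

open Polynomial in
lemma eval_charPol (m : ℕ) (z : ℂ) :
    (charPol m).eval z = ∏ j ∈ Finset.range (m - 1), (z + (j + 1)) - Nat.factorial m := by
  simp [charPol, eval_prod]

open Polynomial in
lemma charPol_natDegree {m : ℕ} : (charPol m).natDegree = m - 1 := by
  unfold charPol
  rw [natDegree_sub_C, natDegree_prod_of_monic _ _ fun j _ => monic_X_add_C _]
  simp only [natDegree_X_add_C]; simp

open Polynomial in
lemma charPol_ne_zero {m : ℕ} (h2 : 2 ≤ m) : charPol m ≠ 0 := by
  intro h
  have := charPol_natDegree (m := m)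
  rw [h] at this; simp at this; omega

open Polynomial in
lemma derivative_charPol_ne_zero {m : ℕ} (h2 : 2 ≤ m) {z : ℂ} (hz : (charPol m).eval z = 0) :
    (derivative (charPol m)).eval z ≠ 0 := by
  rw [eval_charPol, sub_eq_zero] at hz
  have hne : ∀ j ∈ Finset.range (m - 1), z + (j + 1) ≠ 0 := by
    rw [← Finset.prod_ne_zero_iff, hz]; exact_mod_cast Nat.factorial_ne_zero m
  intro hd
  have hS : ∑ j ∈ Finset.range (m - 1), (z + (j + 1))⁻¹ = 0 := by
    rw [charPol, derivative_sub, derivative_C, sub_zero, derivative_prod_finset,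
      eval_finsetSum] at hd
    have h3 : ∀ j ∈ Finset.range (m - 1), (((Finset.range (m - 1)).erase j).prod
        (fun j : ℕ => (X + C ((j : ℂ) + 1))) * derivative (X + C ((j : ℂ) + 1))).eval z =
        Nat.factorial m * (z + (j + 1))⁻¹ := by
      intro j hj
      rw [← hz, ← Finset.mul_prod_erase _ _ hj]
      have := hne j hj
      simp [eval_prod]
      field_simp
    rw [Finset.sum_congr rfl h3, ← Finset.mul_sum] at hd
    rcases mul_eq_zero.1 hd with h | h
    · exact absurd h (by exact_mod_cast Nat.factorial_ne_zero m)
    · exact h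
  have hmem : 0 ∈ Finset.range (m - 1) := by simp; omega
  have him : z.im = 0 := by
    have h3 := congrArg Complex.im hS
    rw [Complex.im_sum] at h3
    simp only [Complex.inv_im, Complex.zero_im] at h3
    have h4 : z.im * ∑ j ∈ Finset.range (m - 1), (Complex.normSq (z + (j + 1)))⁻¹ = 0 := by
      rw [Finset.mul_sum, ← neg_eq_zero, ← h3, ← Finset.sum_neg_distrib]
      refine Finset.sum_congr rfl fun j _ => ?_
      simp; ring
    rcases mul_eq_zero.1 h4 with h | h
    · exact h
    · have : 0 < ∑ j ∈ Finset.range (m - 1), (Complex.normSq (z + (j + 1)))⁻¹ :=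
        Finset.sum_pos (fun j hj => inv_pos.2 (Complex.normSq_pos.2 (hne j hj))) ⟨0, hmem⟩
      linarith
  have hzr : z = -((-z.re : ℝ) : ℂ) := by apply Complex.ext <;> simp [him]
  have hSr : ∑ j ∈ Finset.range (m - 1), (z.re + (j + 1))⁻¹ = 0 := by
    rw [hzr] at hS; push_cast at hS; rw [neg_neg] at hS
    exact_mod_cast hS
  refine not_root_of_neg h2 (-z.re) ?_ ?_ (by rw [← hzr]; exact hz)
  · by_contra hc
    push Not at hc
    have : 0 < ∑ j ∈ Finset.range (m - 1), (z.re + (j + 1))⁻¹ :=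
      Finset.sum_pos (fun j _ => inv_pos.2 (by linarith [(Nat.cast_nonneg j : (0:ℝ) ≤ j)]))
        ⟨0, hmem⟩
    linarith
  · by_contra hc
    push Not at hc
    have : 0 < ∑ j ∈ Finset.range (m - 1), -(z.re + (j + 1))⁻¹ :=
      Finset.sum_pos (fun j hj => by
        have : (j : ℝ) + 1 < m := by
          have := Finset.mem_range.1 hj
          exact_mod_cast (by omega : j + 1 < m)
        rw [← inv_neg]
        exact inv_pos.2 (by linarith)) ⟨0, hmem⟩
    rw [Finset.sum_neg_distrib] at this
    linarith

open Polynomial in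
lemma card_charPol_roots {m : ℕ} (h2 : 2 ≤ m) : (charPol m).roots.toFinset.card = m - 1 := by
  have hn : (charPol m).roots.Nodup := by
    rw [Multiset.nodup_iff_count_le_one]
    intro z
    rw [count_roots]
    by_contra hc
    push Not at hc
    rw [one_lt_rootMultiplicity_iff_isRoot (charPol_ne_zero h2)] at hc
    exact derivative_charPol_ne_zero h2 hc.1 hc.2
  rw [Multiset.toFinset_card_of_nodup hn, ← charPol_natDegree (m := m)]
  exact splits_iff_card_roots.1 (IsAlgClosed.splits _)

lemma mem_charPol_roots {m : ℕ} (h2 : 2 ≤ m) {z : ℂ} :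
    z ∈ (charPol m).roots.toFinset ↔
      ∏ j ∈ Finset.range (m - 1), (z + (j + 1)) = Nat.factorial m := by
  rw [Multiset.mem_toFinset, Polynomial.mem_roots (charPol_ne_zero h2), Polynomial.IsRoot,
    eval_charPol, sub_eq_zero]

/-! ### Eigenfunctionals -/

/-- The eigenfunctional with eigenvalue `z`, normalized to be `1` at type `0`. -/
noncomputable def eig (m : ℕ) (z : ℂ) : ℕ → ℂ
  | 0 => 1
  | s + 1 => eig m z s + z / (act m s : ℂ) * eig m z s - if m - 2 ≤ s then 1 else 0

lemma act_pos {m s : ℕ} (h : s < 2 * m - 2) : 0 < act m s := by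
  unfold act; split_ifs <;> omega

lemma act_last {m : ℕ} : act m (2 * m - 2) = 0 := by
  unfold act; split_ifs <;> omega

lemma act_mul_incr_eig {m s : ℕ} (z : ℂ) (h : s < 2 * m - 2) :
    (act m s : ℂ) * incr m (eig m z) s = z * eig m z s := by
  have h0 : (act m s : ℂ) ≠ 0 := by exact_mod_cast (act_pos h).ne'
  simp only [incr, eig]
  split_ifs <;> field_simp <;> ring

lemma eig_mul_factorial {m : ℕ} (z : ℂ) (s : ℕ) (h : s ≤ m - 2) :
    eig m z s * (s + 1).factorial = ∏ j ∈ Finset.range s, (z + ((j + 1 : ℕ) + 1)) := by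
  induction s with
  | zero => simp [eig]
  | succ s ih =>
    have ha : act m s = s + 2 := by unfold act; rw [if_pos (by omega)]
    have h0 : (s : ℂ) + 2 ≠ 0 := by exact_mod_cast (by omega : s + 2 ≠ 0)
    rw [Finset.prod_range_succ, ← ih (by omega), eig, if_neg (by omega), ha,
      Nat.factorial_succ (s + 1)]
    push_cast
    field_simp
    ring

lemma eig_last_aux {m : ℕ} (h2 : 2 ≤ m) (z : ℂ) (r : ℕ) (hr : r ≤ m) :
    (z + 1) * eig m z (m - 2 + r) - ((m : ℂ) - r) =
      ((z + 1) * eig m z (m - 2) - m) * ∏ j ∈ Finset.range r, (1 + z / ((m : ℂ) - j)) := by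
  induction r with
  | zero => simp
  | succ r ih =>
    have ha : (act m (m - 2 + r) : ℂ) = (m : ℂ) - r := by
      have : act m (m - 2 + r) = m - r := by unfold act; rw [if_neg (by omega)]; omega
      rw [this, Nat.cast_sub (by omega)]
    have h0 : (m : ℂ) - r ≠ 0 := by
      rw [sub_ne_zero]; exact_mod_cast (by omega : m ≠ r)
    rw [Finset.prod_range_succ, ← mul_assoc, ← ih (by omega), ← add_assoc, eig,
      if_pos (by omega), ha]
    push_cast
    field_simp
    ring

lemma eig_last {m : ℕ} (h2 : 2 ≤ m) (z : ℂ) :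
    (z + 1) * eig m z (2 * m - 2) * (m - 1).factorial =
      (∏ j ∈ Finset.range (m - 1), (z + (j + 1)) - m.factorial) *
        ∏ j ∈ Finset.range m, (1 + z / ((m : ℂ) - j)) := by
  have h := eig_last_aux h2 z m le_rfl
  rw [show m - 2 + m = 2 * m - 2 by omega, sub_self, sub_zero] at h
  have h3 := eig_mul_factorial (m := m) z (m - 2) le_rfl
  obtain ⟨k, rfl⟩ : ∃ k, m = k + 2 := ⟨m - 2, by omega⟩
  simp only [Nat.add_sub_cancel, show k + 2 - 1 = k + 1 by omega] at h h3 ⊢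
  rw [h, Finset.prod_range_succ' _ k, ← h3, Nat.factorial_succ (k + 1)]
  push_cast
  ring

/-- The eigenvalues other than `1`. -/
noncomputable def spec (m : ℕ) : Finset ℂ :=
  (insert 0 ((Finset.Icc 2 m).image (fun i : ℕ => -(i : ℂ)))) ∪ (charPol m).roots.toFinset.erase 1

lemma mem_spec {m : ℕ} (h2 : 2 ≤ m) {z : ℂ} : z ∈ spec m ↔
    (z = 0 ∨ ∃ i : ℕ, (2 ≤ i ∧ i ≤ m) ∧ -(i : ℂ) = z) ∨
      (z ≠ 1 ∧ ∏ j ∈ Finset.range (m - 1), (z + (j + 1)) = Nat.factorial m) := by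
  rw [spec, Finset.mem_union, Finset.mem_erase, mem_charPol_roots h2]
  simp

lemma re_lt_half_of_mem_spec {m : ℕ} (h2 : 2 ≤ m) (h26 : m ≤ 26) {z : ℂ} (hz : z ∈ spec m) :
    z.re < 1 / 2 := by
  rcases (mem_spec h2).1 hz with (rfl | ⟨i, _, rfl⟩) | ⟨h1, h⟩
  · norm_num
  · simp only [Complex.neg_re, Complex.natCast_re]
    have : (0 : ℝ) ≤ i := by positivity
    linarith
  · exact re_lt_half h2 h26 h h1

lemma mul_eig_last {m : ℕ} (h2 : 2 ≤ m) {z : ℂ} (hz : z ∈ spec m) :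
    z * eig m z (2 * m - 2) = 0 := by
  have hf : ((m - 1).factorial : ℂ) ≠ 0 := by exact_mod_cast Nat.factorial_ne_zero _
  have hl := eig_last h2 z
  rcases (mem_spec h2).1 hz with (rfl | ⟨i, hi, rfl⟩) | ⟨h1, h⟩
  · simp
  · have h1 : ∏ j ∈ Finset.range m, (1 + -(i : ℂ) / ((m : ℂ) - j)) = 0 := by
      refine Finset.prod_eq_zero (i := m - i) (by simp; omega) ?_
      have : (i : ℂ) ≠ 0 := by exact_mod_cast (by omega : i ≠ 0)
      rw [Nat.cast_sub hi.2]
      field_simp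
      ring_nf
      simp [this]
    rw [h1, mul_zero] at hl
    have h3 : (-(i : ℂ) + 1) ≠ 0 := by
      intro h
      have h4 : ((i : ℕ) : ℂ) = ((1 : ℕ) : ℂ) := by push_cast; linear_combination -h
      have := Nat.cast_injective h4
      omega
    rcases mul_eq_zero.1 hl with h | h
    · rcases mul_eq_zero.1 h with h | h
      · exact absurd h h3
      · rw [h, mul_zero]
    · exact absurd h hf
  · have hne : ∀ j ∈ Finset.range (m - 1), z + (j + 1) ≠ 0 := by
      rw [← Finset.prod_ne_zero_iff, h]; exact_mod_cast Nat.factorial_ne_zero m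
    have h3 := hne 0 (by simp; omega)
    simp only [Nat.cast_zero, zero_add] at h3
    rw [h, sub_self, zero_mul] at hl
    rcases mul_eq_zero.1 hl with h | h
    · rcases mul_eq_zero.1 h with h | h
      · exact absurd h h3
      · rw [h, mul_zero]
    · exact absurd h hf

lemma act_mul_incr_eig_of_mem {m s : ℕ} (h2 : 2 ≤ m) {z : ℂ} (hz : z ∈ spec m)
    (h : s < 2 * m - 1) : (act m s : ℂ) * incr m (eig m z) s = z * eig m z s := by
  rcases Nat.lt_or_ge s (2 * m - 2) with h' | h'
  · exact act_mul_incr_eig z h'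
  · obtain rfl : s = 2 * m - 2 := by omega
    rw [act_last, mul_eig_last h2 hz]; simp

lemma incr_act {m s : ℕ} (h2 : 2 ≤ m) (h : s < 2 * m - 2) :
    incr m (fun s => (act m s : ℂ)) s = 1 := by
  have h3 : act m 0 = 2 := by unfold act; split_ifs <;> omega
  rcases Nat.lt_or_ge s (m - 2) with h' | h'
  · have h1 : act m (s + 1) = act m s + 1 := by unfold act; split_ifs <;> omega
    simp only [incr]
    rw [h1, if_neg (by omega)]; push_cast; ring
  · have h1 : act m s = act m (s + 1) + 1 := by unfold act; split_ifs <;> omega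
    simp only [incr]
    rw [h1, if_pos (by omega), h3]; push_cast; ring

lemma one_notMem_spec {m : ℕ} (h2 : 2 ≤ m) : (1 : ℂ) ∉ spec m := by
  rw [mem_spec h2]
  rintro ((h | ⟨i, hi, h⟩) | ⟨h, _⟩)
  · exact one_ne_zero h
  · have := congrArg Complex.re h
    simp only [Complex.neg_re, Complex.natCast_re, Complex.one_re] at this
    have : (0 : ℝ) ≤ i := by positivity
    linarith
  · exact h rfl

lemma card_spec {m : ℕ} (h2 : 2 ≤ m) : (spec m).card = 2 * m - 2 := by
  rw [spec, Finset.card_union_of_disjoint, Finset.card_insert_of_notMem,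
    Finset.card_image_of_injective, Finset.card_erase_of_mem, card_charPol_roots h2]
  · simp; omega
  · rw [mem_charPol_roots h2]
    have := factorial_eq_prod h2
    have h3 : ((Nat.factorial m : ℝ) : ℂ) =
      ((∏ j ∈ Finset.range (m - 1), ((1 : ℝ) + (j + 1)) : ℝ) : ℂ) := by rw [this]
    push_cast at h3
    rw [h3]
  · intro i j hij
    simpa using hij
  · simp only [Finset.mem_image, Finset.mem_Icc, not_exists, not_and]
    intro i hi h
    have : (i : ℂ) ≠ 0 := by exact_mod_cast (by omega : i ≠ 0)
    exact this (by simpa using h)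
  · rw [Finset.disjoint_left]
    intro z hz hz'
    rw [Finset.mem_erase, mem_charPol_roots h2] at hz'
    simp only [Finset.mem_insert, Finset.mem_image, Finset.mem_Icc] at hz
    rcases hz with rfl | ⟨i, hi, rfl⟩
    · exact not_root_of_neg h2 0 le_rfl (by positivity) (by simpa using hz'.2)
    · exact not_root_of_neg h2 i (by positivity) (by exact_mod_cast hi.2) (by simpa using hz'.right)

/-- The linear operator `w ↦ act * incr w` on functionals of the node types. -/
noncomputable def evol (m : ℕ) : Module.End ℂ (Fin (2 * m - 1) → ℂ) where
  toFun w s := (act m s : ℂ) * incr m (fun j => if h : j < 2 * m - 1 then w ⟨j, h⟩ else 0) s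
  map_add' w w' := by
    funext s
    simp only [incr, Pi.add_apply]
    split_ifs <;> ring
  map_smul' a w := by
    funext s
    simp only [incr, Pi.smul_apply, smul_eq_mul, RingHom.id_apply]
    split_ifs <;> ring

lemma evol_apply {m : ℕ} (u : ℕ → ℂ) (s : Fin (2 * m - 1)) :
    evol m (fun j => u j) s = (act m s : ℂ) * incr m u s := by
  have hs := s.2
  rcases Nat.lt_or_ge s.1 (2 * m - 2) with h | h
  · simp only [evol, LinearMap.coe_mk, AddHom.coe_mk, incr]
    rw [dif_pos (by omega), dif_pos (by omega), dif_pos (by omega)]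
  · have : s.1 = 2 * m - 2 := by omega
    simp only [evol, LinearMap.coe_mk, AddHom.coe_mk, this, act_last]
    simp

lemma exists_decomp {m : ℕ} (h2 : 2 ≤ m) (u : ℕ → ℂ) : ∃ (a : ℂ) (c : ℂ → ℂ),
    ∀ s < 2 * m - 1, u s = a * act m s + ∑ z ∈ spec m, c z * eig m z s := by
  obtain ⟨S, hS⟩ : ∃ S : Finset ℂ, S = insert 1 (spec m) := ⟨_, rfl⟩
  let v : S → ℕ → ℂ := fun z => if z.1 = 1 then fun s => (act m s : ℂ) else eig m z.1
  let w : S → Fin (2 * m - 1) → ℂ := fun z s => v z s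
  have hcard : Fintype.card S = 2 * m - 1 := by
    rw [Fintype.card_coe, hS, Finset.card_insert_of_notMem (one_notMem_spec h2), card_spec h2]; omega
  have hev : ∀ z : S, (evol m).HasEigenvector z.1 (w z) := by
    intro z
    refine ⟨Module.End.mem_eigenspace_iff.2 ?_, ?_⟩
    · funext s
      have hs := s.2
      change evol m (fun j => v z j) s = z.1 * v z s
      rw [evol_apply]
      by_cases h : z.1 = 1
      · simp only [v, h, if_true]
        rcases Nat.lt_or_ge s.1 (2 * m - 2) with h' | h'
        · rw [incr_act h2 h', mul_one, one_mul]
        · have : s.1 = 2 * m - 2 := by omega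
          rw [this, act_last]; simp
      · simp only [v, h, if_false]
        exact act_mul_incr_eig_of_mem h2
          (Finset.mem_of_mem_insert_of_ne (hS ▸ z.2) h) hs
    · intro h
      have h3 := congrFun h ⟨0, by omega⟩
      change v z 0 = 0 at h3
      by_cases h : z.1 = 1
      · simp only [v, h, if_true] at h3
        have : act m 0 = 0 := by exact_mod_cast h3
        have := act_pos (m := m) (s := 0) (by omega)
        omega
      · simp [v, h, eig] at h3
  have hli : LinearIndependent ℂ w :=
    Module.End.eigenvectors_linearIndependent' (evol m) (fun z : S => z.1)
      Subtype.val_injective w hev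
  have hne : Nonempty S := ⟨⟨1, hS ▸ Finset.mem_insert_self _ _⟩⟩
  let b := basisOfLinearIndependentOfCardEqFinrank hli (by rw [hcard]; simp)
  let x := b.repr (fun s => u s)
  refine ⟨if h : (1 : ℂ) ∈ S then x ⟨1, h⟩ else 0,
    fun z => if h : z ∈ S then x ⟨z, h⟩ else 0, fun s hs => ?_⟩
  have h3 := congrFun (b.sum_repr (fun s => u s)) ⟨s, hs⟩
  simp only [Finset.sum_apply, Pi.smul_apply, smul_eq_mul] at h3
  rw [← h3]
  let F : ℂ → ℂ := fun z => (if h : z ∈ S then x ⟨z, h⟩ else 0) *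
    (if z = 1 then (act m s : ℂ) else eig m z s)
  have h4 : ∀ z : S, b.repr (fun s => u s) z * b z ⟨s, hs⟩ = F z.1 := by
    intro z
    simp only [F, b, coe_basisOfLinearIndependentOfCardEqFinrank, dif_pos z.2]
    congr 1
    simp only [w, v]
    split_ifs <;> rfl
  rw [Finset.sum_congr rfl fun z _ => h4 z]
  rw [Finset.sum_coe_sort S F, show ∑ z ∈ S, F z = ∑ z ∈ insert 1 (spec m), F z from
    Finset.sum_congr hS fun _ _ => rfl, Finset.sum_insert (one_notMem_spec h2)]
  congr 1
  · simp only [F, if_true]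
  · refine Finset.sum_congr rfl fun z hz => ?_
    simp only [F]
    have : z ≠ 1 := by rintro rfl; exact one_notMem_spec h2 hz
    rw [if_neg this]

/-! ### The limiting frequencies of the types -/

/-- The asymptotic density of the nodes of type `s`. -/
noncomputable def dens (m s : ℕ) : ℝ :=
  if s < m - 2 then 1 / ((Hm m - 1) * ((s + 2) * (s + 3))) else 1 / ((Hm m - 1) * (m * (m + 1)))

/-- The limit of `stat w / n`. -/
noncomputable def nu {E : Type*} [AddCommGroup E] [Module ℝ E] (m : ℕ) (w : ℕ → E) : E :=
  ∑ s ∈ Finset.range (2 * m - 1), dens m s • w s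

lemma Hm_gt_one {m : ℕ} (h2 : 2 ≤ m) : 1 < Hm m := by
  obtain ⟨k, rfl⟩ : ∃ k, m = k + 2 := ⟨m - 2, by omega⟩
  rw [Hm, Finset.sum_range_succ']
  have : (0 : ℝ) < ∑ i ∈ Finset.range (k + 1), 1 / (((i + 1 : ℕ) : ℝ) + 1) :=
    Finset.sum_pos (fun i _ => by positivity) ⟨0, by simp⟩
  simp at this ⊢
  linarith

lemma dens_pos {m : ℕ} (h2 : 2 ≤ m) (s : ℕ) : 0 < dens m s := by
  have := Hm_gt_one h2
  have h : 0 < Hm m - 1 := by linarith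
  have : 0 < m := by omega
  unfold dens; split_ifs <;> positivity

lemma dens_mul_act_zero {m : ℕ} (h2 : 2 ≤ m) :
    dens m 0 * act m 0 + dens m 0 = 1 / (2 * (Hm m - 1)) := by
  have := Hm_gt_one h2
  have h : Hm m - 1 ≠ 0 := by linarith
  unfold dens act
  split_ifs with h1
  · push_cast; field_simp; norm_num
  · obtain rfl : m = 2 := by omega
    norm_num
    field_simp; norm_num

lemma dens_mul_act_succ {m s : ℕ} (h2 : 2 ≤ m) (hs : s + 1 < 2 * m - 1) :
    dens m (s + 1) * act m (s + 1) + dens m (s + 1) = dens m s * act m s := by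
  have := Hm_gt_one h2
  have h : Hm m - 1 ≠ 0 := by linarith
  have hm : (m : ℝ) ≠ 0 := by exact_mod_cast (by omega : m ≠ 0)
  unfold dens
  rcases lt_trichotomy (s + 1) (m - 2) with h1 | h1 | h1
  · have h3 : act m (s + 1) = s + 3 := by unfold act; rw [if_pos (by omega)]
    have h4 : act m s = s + 2 := by unfold act; split_ifs <;> omega
    rw [if_pos h1, if_pos (by omega), h3, h4]
    push_cast; field_simp; ring
  · have h3 : act m (s + 1) = m := by unfold act; split_ifs <;> omega
    have h4 : act m s = s + 2 := by unfold act; split_ifs <;> omega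
    rw [if_neg (by omega), if_pos (by omega), h3, h4]
    have : (m : ℝ) = s + 3 := by exact_mod_cast (by omega : m = s + 3)
    push_cast; rw [this] at hm ⊢; field_simp; try ring
  · have h3 : act m s = act m (s + 1) + 1 := by unfold act; split_ifs <;> omega
    rw [if_neg (by omega), if_neg (by omega), h3]
    push_cast; ring

lemma sum_dens_telescope {m : ℕ} (h2 : 2 ≤ m) (w : ℕ → ℂ) (n : ℕ) (hn : n < 2 * m - 1) :
    ∑ s ∈ Finset.range (n + 1),
      ((dens m s * act m s : ℝ) * (w (s + 1) - w s) - (dens m s : ℂ) * w s) =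
      (dens m n * act m n : ℝ) * w (n + 1) - ((1 / (2 * (Hm m - 1)) : ℝ) : ℂ) * w 0 := by
  induction n with
  | zero =>
    rw [← dens_mul_act_zero h2]; simp; ring
  | succ n ih =>
    rw [Finset.sum_range_succ, ih (by omega), ← dens_mul_act_succ h2 hn]
    push_cast; ring

lemma sum_dens_full {m : ℕ} (h2 : 2 ≤ m) :
    ∑ s ∈ Finset.Ico (m - 2) (2 * m - 1), dens m s * act m s = 1 / (2 * (Hm m - 1)) := by
  have := Hm_gt_one h2
  have h : Hm m - 1 ≠ 0 := by linarith
  have hm : (m : ℝ) ≠ 0 := by exact_mod_cast (by omega : m ≠ 0)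
  rw [Finset.sum_Ico_eq_sum_range, show 2 * m - 1 - (m - 2) = m + 1 by omega]
  have h1 : ∀ i ∈ Finset.range (m + 1), dens m (m - 2 + i) * act m (m - 2 + i) =
      1 / ((Hm m - 1) * (m * (m + 1))) * ((m - i : ℕ) : ℝ) := by
    intro i hi
    have h3 : act m (m - 2 + i) = m - i := by
      have := Finset.mem_range.1 hi
      unfold act; split_ifs <;> omega
    rw [dens, if_neg (by omega), h3]
  have h4 : ∑ i ∈ Finset.range (m + 1), ((m - i : ℕ) : ℝ) = m * (m + 1) / 2 := by
    have h6 := Finset.sum_range_reflect (fun i => ((i : ℕ) : ℝ)) (m + 1)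
    simp only [Nat.add_sub_cancel] at h6
    rw [h6]
    have := Finset.sum_range_id_mul_two (m + 1)
    rw [Nat.add_sub_cancel] at this
    have h5 : (∑ i ∈ Finset.range (m + 1), (i : ℝ)) * 2 = (m + 1) * m := by
      have := congrArg (Nat.cast : ℕ → ℝ) this
      push_cast at this
      exact this
    linarith
  rw [Finset.sum_congr rfl h1, ← Finset.mul_sum, h4]
  field_simp

lemma nu_act_mul_incr {m : ℕ} (h2 : 2 ≤ m) (w : ℕ → ℂ) :
    nu m (fun s => (act m s : ℂ) * incr m w s) = nu m w := by
  have h1 := sum_dens_telescope h2 w (2 * m - 2) (by omega)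
  rw [act_last, show 2 * m - 2 + 1 = 2 * m - 1 by omega] at h1
  simp only [Nat.cast_zero, mul_zero, Complex.ofReal_zero, zero_mul, zero_sub] at h1
  rw [Finset.sum_sub_distrib] at h1
  have h3 : ∑ s ∈ Finset.range (2 * m - 1), (if m - 2 ≤ s then ((dens m s * act m s : ℝ) : ℂ) * w 0
      else 0) = ((1 / (2 * (Hm m - 1)) : ℝ) : ℂ) * w 0 := by
    rw [← sum_dens_full h2, Complex.ofReal_sum, Finset.sum_mul, ← Finset.sum_filter]
    refine Finset.sum_congr ?_ fun _ _ => rfl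
    ext s; simp; omega
  unfold nu
  simp only [Complex.real_smul]
  have h4 : ∀ s ∈ Finset.range (2 * m - 1), (dens m s : ℂ) * ((act m s : ℂ) * incr m w s) =
      ((dens m s * act m s : ℝ) : ℂ) * (w (s + 1) - w s) +
        (if m - 2 ≤ s then ((dens m s * act m s : ℝ) : ℂ) * w 0 else 0) := by
    intro s _
    simp only [incr]
    split_ifs <;> (push_cast; ring)
  rw [Finset.sum_congr rfl h4, Finset.sum_add_distrib, h3]
  linear_combination h1

lemma sum_dens_leaf {m n : ℕ} (hn : n ≤ m - 2) (h2 : 2 ≤ m) :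
    ∑ s ∈ Finset.range n, dens m s = 1 / (Hm m - 1) * (1 / 2 - 1 / (n + 2)) := by
  have := Hm_gt_one h2
  have h : Hm m - 1 ≠ 0 := by linarith
  induction n with
  | zero => simp
  | succ n ih =>
    rw [Finset.sum_range_succ, ih (by omega), dens, if_pos (by omega)]
    push_cast
    field_simp
    ring

lemma nu_act {m : ℕ} (h2 : 2 ≤ m) : nu m (fun s => (act m s : ℂ)) = 1 := by
  have := Hm_gt_one h2
  have h : Hm m - 1 ≠ 0 := by linarith
  unfold nu
  simp only [Complex.real_smul]
  have h1 : ∑ s ∈ Finset.range (2 * m - 1), dens m s * act m s = 1 := by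
    rw [Finset.range_eq_Ico, ← Finset.sum_Ico_consecutive _ (Nat.zero_le (m - 2)) (by omega),
      sum_dens_full h2, ← Finset.range_eq_Ico]
    have h3 : ∀ n ≤ m - 2, ∑ s ∈ Finset.range n, dens m s * act m s =
        1 / (Hm m - 1) * (Hm (n + 2) - 3 / 2) := by
      intro n hn
      induction n with
      | zero => simp [Hm, Finset.sum_range_succ]; norm_num
      | succ n ih =>
        have h4 : act m n = n + 2 := by unfold act; split_ifs; rfl; omega
        rw [Finset.sum_range_succ, ih (by omega), dens, if_pos (by omega), h4,
          show Hm (n + 1 + 2) = Hm (n + 2) + 1 / (((n + 2 : ℕ) : ℝ) + 1) from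
            Finset.sum_range_succ _ _]
        push_cast
        field_simp
        ring
    rw [h3 _ le_rfl, show m - 2 + 2 = m by omega]
    field_simp
    ring
  exact_mod_cast h1

/-- The indicator of the types of the nodes of out-degree `k`. -/
noncomputable def degInd (m k s : ℕ) : ℝ :=
  if (if k = 0 then s ≤ m - 2 else s = m - 2 + k) then 1 else 0

lemma nu_degInd {m k : ℕ} (h2 : 2 ≤ m) (hk : k ≤ m) : nu m (degInd m k) = muDeg m k := by
  have := Hm_gt_one h2
  have h : Hm m - 1 ≠ 0 := by linarith
  have hm : (m : ℝ) ≠ 0 := by exact_mod_cast (by omega : m ≠ 0)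
  unfold nu degInd muDeg
  simp only [smul_eq_mul, mul_ite, mul_one, mul_zero]
  split_ifs with h0
  · rw [← Finset.sum_filter]
    have h3 : (Finset.range (2 * m - 1)).filter (fun s => s ≤ m - 2) =
        Finset.range (m - 2 + 1) := by
      ext s; simp; omega
    rw [h3, Finset.sum_range_succ, sum_dens_leaf le_rfl h2, dens, if_neg (by omega),
      show ((m - 2 : ℕ) : ℝ) + 2 = m by exact_mod_cast (by omega : m - 2 + 2 = m)]
    field_simp
    ring
  · rw [Finset.sum_ite_eq', if_pos (by simp; omega), dens, if_neg (by omega)]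
    rw [mul_assoc]

lemma nu_eig {m : ℕ} (h2 : 2 ≤ m) {z : ℂ} (hz : z ∈ spec m) : nu m (eig m z) = 0 := by
  have h := nu_act_mul_incr h2 (eig m z)
  have h1 : nu m (fun s => (act m s : ℂ) * incr m (eig m z) s) = z * nu m (eig m z) := by
    unfold nu
    rw [Finset.mul_sum]
    refine Finset.sum_congr rfl fun s hs => ?_
    simp only [act_mul_incr_eig_of_mem h2 hz (Finset.mem_range.1 hs), Complex.real_smul]
    ring
  rw [h1] at h
  have h3 : z - 1 ≠ 0 := by
    rw [sub_ne_zero]; rintro rfl; exact one_notMem_spec h2 hz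
  exact (mul_eq_zero.1 (by linear_combination h : (z - 1) * nu m (eig m z) = 0)).resolve_left h3

/-! ### Second moment bounds -/

section Stat
variable {m : ℕ} {E F : Type*}

lemma stat_map [AddCommMonoid E] [AddCommMonoid F] (g : E →+ F) (w : ℕ → E) (T : MTree m) :
    stat (fun s => g (w s)) T = g (stat w T) := by
  rw [stat, stat, map_multiset_sum, Multiset.map_map]; rfl

lemma stat_add [AddCommMonoid E] (u w : ℕ → E) (T : MTree m) :
    stat (fun s => u s + w s) T = stat u T + stat w T :=
  Multiset.sum_map_add

lemma stat_const_mul (a : ℂ) (w : ℕ → ℂ) (T : MTree m) :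
    stat (fun s => a * w s) T = a * stat w T := stat_map (AddMonoidHom.mulLeft a) w T

lemma stat_const_mul_real (a : ℝ) (w : ℕ → ℝ) (T : MTree m) :
    stat (fun s => a * w s) T = a * stat w T := stat_map (AddMonoidHom.mulLeft a) w T

lemma stat_ofReal (w : ℕ → ℝ) (T : MTree m) :
    stat (fun s => (w s : ℂ)) T = (stat w T : ℝ) := stat_map Complex.ofRealHom.toAddMonoidHom w T

lemma stat_re (w : ℕ → ℂ) (T : MTree m) :
    stat (fun s => (w s).re) T = (stat w T).re := stat_map Complex.reAddGroupHom w T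

lemma stat_finset_sum {ι : Type*} (S : Finset ι) (c : ι → ℂ) (w : ι → ℕ → ℂ) (T : MTree m) :
    stat (fun s => ∑ i ∈ S, c i * w i s) T = ∑ i ∈ S, c i * stat (w i) T := by
  classical
  induction S using Finset.induction_on with
  | empty => simp [stat]
  | insert a S ha ih =>
    simp only [Finset.sum_insert ha]
    rw [stat_add, stat_const_mul, ih]

lemma stat_congr [AddCommMonoid E] {u w : ℕ → E} {T : MTree m} (h2 : 2 ≤ m) (hT : Valid T)
    (h : ∀ s < 2 * m - 1, u s = w s) : stat u T = stat w T := by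
  unfold stat
  rw [Multiset.map_congr rfl fun s hs => h s (types_lt T hT h2 s hs)]

lemma stat_mono {u w : ℕ → ℝ} {T : MTree m} (h2 : 2 ≤ m) (hT : Valid T)
    (h : ∀ s < 2 * m - 1, u s ≤ w s) : stat u T ≤ stat w T :=
  Multiset.sum_map_le_sum_map _ _ fun s hs => h s (types_lt T hT h2 s hs)

lemma norm_stat_le (w : ℕ → ℂ) (T : MTree m) : ‖stat w T‖ ≤ stat (fun s => ‖w s‖) T := by
  unfold stat
  refine (norm_multiset_sum_le _).trans_eq ?_
  rw [Multiset.map_map]; rfl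

lemma stat_act_real {T : MTree m} (h2 : 2 ≤ m) (hT : Valid T) (h0 : T ≠ MTree.lf 0) :
    stat (fun s => (act m s : ℝ)) T = T.keys + 1 := by
  have h := stat_act h2 T hT h0
  have h3 := stat_ofReal (fun s => (act m s : ℝ)) T
  push_cast at h3
  rw [h] at h3
  exact_mod_cast h3.symm

lemma stat_act_mul_le {T : MTree m} (h2 : 2 ≤ m) (hT : Valid T) (h0 : T ≠ MTree.lf 0)
    {g : ℕ → ℝ} {D : ℝ} (h : ∀ s < 2 * m - 1, g s ≤ D) :
    stat (fun s => (act m s : ℝ) * g s) T ≤ (T.keys + 1) * D := by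
  rw [← stat_act_real h2 hT h0, mul_comm, ← stat_const_mul_real]
  refine stat_mono h2 hT fun s hs => ?_
  rw [mul_comm]
  exact mul_le_mul_of_nonneg_right (h s hs) (by positivity)

lemma norm_stat_act_mul_le {T : MTree m} (h2 : 2 ≤ m) (hT : Valid T) (h0 : T ≠ MTree.lf 0)
    {g : ℕ → ℂ} {D : ℝ} (h : ∀ s < 2 * m - 1, ‖g s‖ ≤ D) :
    ‖stat (fun s => (act m s : ℂ) * g s) T‖ ≤ (T.keys + 1) * D := by
  refine (norm_stat_le _ T).trans ?_
  simp only [norm_mul, Complex.norm_natCast]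
  exact stat_act_mul_le h2 hT h0 h

end Stat

lemma avg_ofReal {m n : ℕ} (f : MTree m → ℝ) :
    avg m n (fun T => (f T : ℂ)) = (avg m n f : ℝ) := by
  simp [avg]

lemma avg_succ_stat_real {m n : ℕ} (h2 : 2 ≤ m) (hn : n ≠ 0) (w : ℕ → ℂ) (φ : ℂ → ℝ) :
    avg m (n + 1) (fun T => φ (stat w T)) = avg m n (fun T => ((n : ℝ) + 1)⁻¹ *
      stat (fun s => (act m s : ℝ) * φ (stat w T + incr m w s)) T) := by
  have h := avg_succ_stat h2 hn w (fun x => (φ x : ℂ))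
  rw [avg_ofReal] at h
  apply Complex.ofReal_injective
  rw [h, ← avg_ofReal]
  refine avg_congr fun π => ?_
  push_cast
  rw [← stat_ofReal]
  push_cast; rfl

lemma second_moment_step {m n : ℕ} (h2 : 2 ≤ m) (hn : n ≠ 0) {z : ℂ} (hz : z ∈ spec m) {D : ℝ}
    (hD : ∀ s < 2 * m - 1, ‖incr m (eig m z) s‖ ^ 2 ≤ D) :
    avg m (n + 1) (fun T => ‖stat (eig m z) T‖ ^ 2) ≤
      (1 + 2 * z.re / (n + 1)) * avg m n (fun T => ‖stat (eig m z) T‖ ^ 2) + D := by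
  rw [avg_succ_stat_real h2 hn (eig m z) (fun x => ‖x‖ ^ 2), ← avg_const_mul,
    ← avg_const (m := m) (n := n) D, ← avg_add]
  refine avg_mono fun π => ?_
  set T := mst m n π
  have hT : Valid T := valid_mst h2 π
  have h0 : T ≠ MTree.lf 0 := mst_ne h2 hn π
  have hk : (T.keys : ℝ) = n := by exact_mod_cast keys_mst h2 π
  set S := stat (eig m z) T with hS
  have h1 : ∀ s, (act m s : ℝ) * ‖S + incr m (eig m z) s‖ ^ 2 =
      ‖S‖ ^ 2 * act m s + (2 * ((starRingEnd ℂ) S * (act m s * incr m (eig m z) s)).re +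
        act m s * ‖incr m (eig m z) s‖ ^ 2) := by
    intro s
    rw [Complex.sq_norm, Complex.sq_norm, Complex.sq_norm]
    simp only [Complex.normSq_apply, Complex.add_re, Complex.add_im, Complex.mul_re,
      Complex.mul_im, Complex.conj_re, Complex.conj_im, Complex.natCast_re, Complex.natCast_im]
    ring
  simp only [h1]
  rw [stat_add, stat_add, stat_const_mul_real, stat_const_mul_real, stat_re, stat_const_mul,
    stat_act_real h2 hT h0, stat_congr h2 hT fun s hs => act_mul_incr_eig_of_mem h2 hz hs,
    stat_const_mul, ← hS, hk]
  have h3 := stat_act_mul_le h2 hT h0 hD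
  rw [hk] at h3
  have h4 : ((starRingEnd ℂ) S * (z * S)).re = z.re * ‖S‖ ^ 2 := by
    rw [Complex.sq_norm]
    simp only [Complex.normSq_apply, Complex.mul_re, Complex.mul_im, Complex.conj_re,
      Complex.conj_im]
    ring
  rw [h4]
  have hn' : (0 : ℝ) < n + 1 := by positivity
  rw [inv_mul_le_iff₀ hn']
  have h5 : ((n : ℝ) + 1) * ((1 + 2 * z.re / (n + 1)) * ‖S‖ ^ 2 + D) =
      ‖S‖ ^ 2 * (n + 1) + 2 * (z.re * ‖S‖ ^ 2) + (n + 1) * D := by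
    field_simp
  rw [h5]
  linarith

lemma second_moment_le {m : ℕ} (h2 : 2 ≤ m) (h26 : m ≤ 26) {z : ℂ} (hz : z ∈ spec m) :
    ∃ K : ℝ, 0 ≤ K ∧ ∀ n : ℕ, n ≠ 0 → avg m n (fun T => ‖stat (eig m z) T‖ ^ 2) ≤ K * n := by
  set X : ℕ → ℝ := fun n => avg m n (fun T => ‖stat (eig m z) T‖ ^ 2) with hX
  have hX0 : ∀ n, 0 ≤ X n := fun n => avg_nonneg fun _ => by positivity
  set D := ∑ s ∈ Finset.range (2 * m - 1), ‖incr m (eig m z) s‖ ^ 2 with hDdef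
  have hD : ∀ s < 2 * m - 1, ‖incr m (eig m z) s‖ ^ 2 ≤ D := fun s hs =>
    Finset.single_le_sum (f := fun s => ‖incr m (eig m z) s‖ ^ 2) (fun _ _ => by positivity)
      (Finset.mem_range.2 hs)
  have hD0 : 0 ≤ D := Finset.sum_nonneg fun _ _ => by positivity
  set β := max (2 * z.re) 0 with hβ
  have hre := re_lt_half_of_mem_spec h2 h26 hz
  have hβ1 : 0 < 1 - β := by
    rw [sub_pos, hβ, max_lt_iff]; constructor <;> linarith
  have hβ0 : 0 ≤ β := le_max_right _ _
  refine ⟨X 1 + D / (1 - β), add_nonneg (hX0 1) (div_nonneg hD0 hβ1.le), fun n hn => ?_⟩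
  induction n with
  | zero => exact absurd rfl hn
  | succ n ih =>
    rcases Nat.eq_zero_or_pos n with rfl | hn'
    · have := div_nonneg hD0 hβ1.le
      simp only [zero_add, Nat.cast_one, mul_one]
      change X 1 ≤ _
      linarith
    · have ih := ih hn'.ne'
      have h3 := second_moment_step h2 hn'.ne' hz hD
      change X (n + 1) ≤ (1 + 2 * z.re / (n + 1)) * X n + D at h3
      change X n ≤ _ at ih
      change X (n + 1) ≤ _
      set K := X 1 + D / (1 - β) with hK
      have hK0 : 0 ≤ K := add_nonneg (hX0 1) (div_nonneg hD0 hβ1.le)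
      have hDK : D ≤ (1 - β) * K := by
        rw [hK, mul_add, mul_div_cancel₀ _ hβ1.ne']
        have := mul_nonneg hβ1.le (hX0 1)
        linarith
      have hn1 : (0 : ℝ) < n + 1 := by positivity
      have h4 : (1 + 2 * z.re / (n + 1)) * X n ≤ (1 + β / (n + 1)) * X n := by
        have : 2 * z.re ≤ β := le_max_left _ _
        have := hX0 n
        gcongr
      have h5 : (1 + β / (n + 1)) * X n ≤ (1 + β / (n + 1)) * (K * n) := by gcongr
      have h6 : (1 + β / (n + 1)) * (K * n) ≤ K * n + β * K := by
        have : β * K * (n / (n + 1)) ≤ β * K * 1 := by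
          gcongr
          rw [div_le_one hn1]; linarith
        calc (1 + β / (n + 1)) * (K * n) = K * n + β * K * (n / (n + 1)) := by ring
          _ ≤ _ := by linarith
      push_cast
      linarith

lemma avg_norm_le_sqrt {m n : ℕ} (f : MTree m → ℂ) :
    avg m n (fun T => ‖f T‖) ≤ Real.sqrt (avg m n (fun T => ‖f T‖ ^ 2)) := by
  have := avg_abs_le_sqrt (m := m) (n := n) (fun T => ‖f T‖)
  simpa using this

lemma nu_decomp {m : ℕ} (h2 : 2 ≤ m) {u : ℕ → ℂ} {a : ℂ} {c : ℂ → ℂ}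
    (h : ∀ s < 2 * m - 1, u s = a * act m s + ∑ z ∈ spec m, c z * eig m z s) : nu m u = a := by
  have h1 : nu m u = a * nu m (fun s => (act m s : ℂ)) + ∑ z ∈ spec m, c z * nu m (eig m z) := by
    unfold nu
    simp only [Complex.real_smul, Finset.mul_sum]
    rw [Finset.sum_comm, ← Finset.sum_add_distrib]
    refine Finset.sum_congr rfl fun s hs => ?_
    rw [h s (Finset.mem_range.1 hs), mul_add, Finset.mul_sum]
    congr 1
    · ring
    · exact Finset.sum_congr rfl fun _ _ => by ring
  rw [h1, nu_act h2, Finset.sum_eq_zero fun z hz => by rw [nu_eig h2 hz, mul_zero]]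
  ring

lemma avg_stat_sub_nu_le {m : ℕ} (h2 : 2 ≤ m) (h26 : m ≤ 26) (u : ℕ → ℂ) :
    ∃ K : ℝ, 0 ≤ K ∧ ∀ n : ℕ, n ≠ 0 →
      avg m n (fun T => ‖stat u T - ((n : ℂ) + 1) * nu m u‖) ≤ K * Real.sqrt n := by
  obtain ⟨a, c, h⟩ := exists_decomp h2 u
  rw [nu_decomp h2 h]
  choose! K hK0 hK using fun z (hz : z ∈ spec m) => second_moment_le h2 h26 hz
  refine ⟨∑ z ∈ spec m, ‖c z‖ * Real.sqrt (K z), Finset.sum_nonneg fun _ _ => by positivity,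
    fun n hn => ?_⟩
  calc avg m n (fun T => ‖stat u T - ((n : ℂ) + 1) * a‖)
      ≤ avg m n (fun T => ∑ z ∈ spec m, ‖c z‖ * ‖stat (eig m z) T‖) := by
        refine avg_mono fun π => ?_
        have hk : ((mst m n π).keys : ℂ) = n := by exact_mod_cast keys_mst h2 π
        rw [stat_congr h2 (valid_mst h2 π) h, stat_add, stat_const_mul,
          stat_act h2 _ (valid_mst h2 π) (mst_ne h2 hn π), hk, stat_finset_sum,
          show a * ((n : ℂ) + 1) + ∑ z ∈ spec m, c z * stat (eig m z) (mst m n π) -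
            ((n : ℂ) + 1) * a = ∑ z ∈ spec m, c z * stat (eig m z) (mst m n π) by ring]
        refine (norm_sum_le _ _).trans_eq ?_
        simp only [norm_mul]
    _ = ∑ z ∈ spec m, ‖c z‖ * avg m n (fun T => ‖stat (eig m z) T‖) := by
        rw [avg_finset_sum]
        simp only [avg_const_mul]
    _ ≤ ∑ z ∈ spec m, ‖c z‖ * (Real.sqrt (K z) * Real.sqrt n) := by
        refine Finset.sum_le_sum fun z hz => ?_
        gcongr
        rw [← Real.sqrt_mul (hK0 z hz)]
        exact (avg_norm_le_sqrt _).trans (Real.sqrt_le_sqrt (hK z hz n hn))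
    _ = _ := by
        rw [Finset.sum_mul]
        exact Finset.sum_congr rfl fun _ _ => by ring

/-! ### Combinations of the eigenfunctionals -/

/-- The functional of the types with coefficients `c` in the eigenbasis. -/
noncomputable def comb (m : ℕ) (c : ℂ → ℂ) (s : ℕ) : ℂ := ∑ z ∈ spec m, c z * eig m z s

/-- The size of a family of coefficients. -/
noncomputable def cnorm (m : ℕ) (c : ℂ → ℂ) : ℝ := ∑ z ∈ spec m, ‖c z‖

/-- Families of coefficients whose functional is real. -/
def RealCoeff (m : ℕ) (c : ℂ → ℂ) : Prop := ∀ s < 2 * m - 1, (comb m c s).im = 0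

/-- The limiting conditional variance per step. -/
noncomputable def quad (m : ℕ) (c : ℂ → ℂ) (s : ℕ) : ℂ :=
  (act m s : ℂ) * incr m (comb m c) s ^ 2

/-- The coefficients of `quad` in the eigenbasis. -/
noncomputable def quadCoeff (m : ℕ) (z z' : ℂ) (s : ℕ) : ℂ :=
  (act m s : ℂ) * (incr m (eig m z) s * incr m (eig m z') s)

lemma cnorm_nonneg (m : ℕ) (c : ℂ → ℂ) : 0 ≤ cnorm m c := Finset.sum_nonneg fun _ _ => norm_nonneg _

lemma norm_sum_le_cnorm {m : ℕ} {c f : ℂ → ℂ} {D : ℝ} (h : ∀ z ∈ spec m, ‖f z‖ ≤ D) :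
    ‖∑ z ∈ spec m, c z * f z‖ ≤ cnorm m c * D := by
  refine (norm_sum_le _ _).trans ?_
  rw [cnorm, Finset.sum_mul]
  refine Finset.sum_le_sum fun z hz => ?_
  rw [norm_mul]
  have := h z hz
  gcongr

lemma norm_sum_sum_le_cnorm {m : ℕ} {c : ℂ → ℂ} {f : ℂ → ℂ → ℂ} {D : ℝ}
    (h : ∀ z ∈ spec m, ∀ z' ∈ spec m, ‖f z z'‖ ≤ D) :
    ‖∑ z ∈ spec m, ∑ z' ∈ spec m, c z * c z' * f z z'‖ ≤ cnorm m c ^ 2 * D := by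
  have : ∑ z ∈ spec m, ∑ z' ∈ spec m, c z * c z' * f z z' =
      ∑ z ∈ spec m, c z * ∑ z' ∈ spec m, c z' * f z z' := by
    refine Finset.sum_congr rfl fun z _ => ?_
    rw [Finset.mul_sum]
    exact Finset.sum_congr rfl fun _ _ => by ring
  rw [this, sq, mul_assoc]
  exact norm_sum_le_cnorm fun z hz => norm_sum_le_cnorm (h z hz)

lemma cnorm_mul_le {m : ℕ} {c f : ℂ → ℂ} {D : ℝ} (h : ∀ z ∈ spec m, ‖f z‖ ≤ D) :
    cnorm m (fun z => f z * c z) ≤ D * cnorm m c := by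
  unfold cnorm
  rw [Finset.mul_sum]
  refine Finset.sum_le_sum fun z hz => ?_
  rw [norm_mul]
  have := h z hz
  gcongr

lemma exists_bound (S : Finset ℂ) (f : ℂ → ℝ) : ∃ D : ℝ, 0 ≤ D ∧ ∀ z ∈ S, f z ≤ D :=
  ⟨∑ z ∈ S, |f z|, Finset.sum_nonneg fun _ _ => abs_nonneg _, fun _ hz =>
    (le_abs_self _).trans (Finset.single_le_sum (f := fun z => |f z|) (fun _ _ => abs_nonneg _) hz)⟩

lemma exists_bound₂ (S : Finset ℂ) (f : ℂ → ℂ → ℝ) :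
    ∃ D : ℝ, 0 ≤ D ∧ ∀ z ∈ S, ∀ z' ∈ S, f z z' ≤ D := by
  choose g hg0 hg using fun z => exists_bound S (f z)
  obtain ⟨D, hD0, hD⟩ := exists_bound S g
  exact ⟨D, hD0, fun z hz z' hz' => (hg z z' hz').trans (hD z hz)⟩

lemma exists_bound_range (n : ℕ) (f : ℕ → ℝ) : ∃ D : ℝ, 0 ≤ D ∧ ∀ s < n, f s ≤ D :=
  ⟨∑ s ∈ Finset.range n, |f s|, Finset.sum_nonneg fun _ _ => abs_nonneg _, fun _ hs =>
    (le_abs_self _).trans (Finset.single_le_sum (f := fun s => |f s|) (fun _ _ => abs_nonneg _)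
      (Finset.mem_range.2 hs))⟩

lemma incr_comb {m : ℕ} (c : ℂ → ℂ) (s : ℕ) :
    incr m (comb m c) s = ∑ z ∈ spec m, c z * incr m (eig m z) s := by
  unfold incr comb
  split_ifs
  · rw [← Finset.sum_sub_distrib, ← Finset.sum_add_distrib]
    exact Finset.sum_congr rfl fun _ _ => by ring
  · rw [add_zero, ← Finset.sum_sub_distrib]
    exact Finset.sum_congr rfl fun _ _ => by ring

lemma act_mul_incr_comb {m s : ℕ} (h2 : 2 ≤ m) (c : ℂ → ℂ) (hs : s < 2 * m - 1) :
    (act m s : ℂ) * incr m (comb m c) s = comb m (fun z => z * c z) s := by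
  rw [incr_comb, comb, Finset.mul_sum]
  refine Finset.sum_congr rfl fun z hz => ?_
  rw [mul_left_comm, act_mul_incr_eig_of_mem h2 hz hs]; ring

lemma comb_add_smul {m : ℕ} (c d : ℂ → ℂ) (a : ℂ) (s : ℕ) :
    comb m (fun z => c z + a * d z) s = comb m c s + a * comb m d s := by
  unfold comb
  rw [Finset.mul_sum, ← Finset.sum_add_distrib]
  exact Finset.sum_congr rfl fun _ _ => by ring

lemma comb_smul {m : ℕ} (c : ℂ → ℂ) (a : ℂ) (s : ℕ) :
    comb m (fun z => a * c z) s = a * comb m c s := by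
  unfold comb
  rw [Finset.mul_sum]
  exact Finset.sum_congr rfl fun _ _ => by ring

lemma cnorm_smul {m : ℕ} (c : ℂ → ℂ) (a : ℂ) :
    cnorm m (fun z => a * c z) = ‖a‖ * cnorm m c := by
  simp only [cnorm, norm_mul, Finset.mul_sum]

lemma stat_comb {m : ℕ} (c : ℂ → ℂ) (T : MTree m) :
    stat (comb m c) T = ∑ z ∈ spec m, c z * stat (eig m z) T :=
  stat_finset_sum (spec m) c (fun z => eig m z) T

lemma RealCoeff.incr_im {m s : ℕ} {c : ℂ → ℂ} (hc : RealCoeff m c) (hs : s < 2 * m - 2) :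
    (incr m (comb m c) s).im = 0 := by
  have h0 := hc s (by omega)
  have h1 := hc (s + 1) (by omega)
  have h3 := hc 0 (by omega)
  unfold incr
  split_ifs <;> simp [h0, h1, h3]

lemma RealCoeff.mul {m : ℕ} (h2 : 2 ≤ m) {c : ℂ → ℂ} (hc : RealCoeff m c) :
    RealCoeff m (fun z => z * c z) := by
  intro s hs
  rw [← act_mul_incr_comb h2 c hs]
  rcases Nat.lt_or_ge s (2 * m - 2) with h | h
  · simp [hc.incr_im h]
  · obtain rfl : s = 2 * m - 2 := by omega
    simp [act_last]

lemma RealCoeff.add_smul {m : ℕ} {c d : ℂ → ℂ} (hc : RealCoeff m c) (hd : RealCoeff m d) (a : ℝ) :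
    RealCoeff m (fun z => c z + a * d z) := by
  intro s hs
  rw [comb_add_smul]
  simp [hc s hs, hd s hs]

lemma RealCoeff.smul {m : ℕ} {c : ℂ → ℂ} (hc : RealCoeff m c) (a : ℝ) :
    RealCoeff m (fun z => a * c z) := by
  intro s hs
  rw [comb_smul]
  simp [hc s hs]

lemma quad_eq_sum {m : ℕ} (c : ℂ → ℂ) (s : ℕ) :
    quad m c s = ∑ z ∈ spec m, ∑ z' ∈ spec m, c z * c z' * quadCoeff m z z' s := by
  rw [quad, incr_comb, sq, Finset.sum_mul_sum, Finset.mul_sum]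
  refine Finset.sum_congr rfl fun z _ => ?_
  rw [Finset.mul_sum]
  refine Finset.sum_congr rfl fun z' _ => ?_
  unfold quadCoeff; ring

lemma nu_quad_eq_sum {m : ℕ} (c : ℂ → ℂ) :
    nu m (quad m c) = ∑ z ∈ spec m, ∑ z' ∈ spec m, c z * c z' * nu m (quadCoeff m z z') := by
  unfold nu
  simp only [quad_eq_sum, Finset.smul_sum, Finset.mul_sum]
  rw [Finset.sum_comm]
  refine Finset.sum_congr rfl fun z _ => ?_
  rw [Finset.sum_comm]
  refine Finset.sum_congr rfl fun z' _ => Finset.sum_congr rfl fun s _ => ?_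
  simp only [Complex.real_smul]; ring

lemma stat_quad_eq_sum {m : ℕ} (c : ℂ → ℂ) (T : MTree m) :
    stat (quad m c) T = ∑ z ∈ spec m, ∑ z' ∈ spec m, c z * c z' * stat (quadCoeff m z z') T := by
  have h : quad m c = fun s => ∑ z ∈ spec m, c z *
      (∑ z' ∈ spec m, c z' * quadCoeff m z z' s) := by
    funext s
    rw [quad_eq_sum]
    refine Finset.sum_congr rfl fun z _ => ?_
    rw [Finset.mul_sum]
    exact Finset.sum_congr rfl fun _ _ => by ring
  rw [h, stat_finset_sum (spec m) c (fun z s => ∑ z' ∈ spec m, c z' * quadCoeff m z z' s)]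
  refine Finset.sum_congr rfl fun z _ => ?_
  rw [stat_finset_sum (spec m) c (fun z' => quadCoeff m z z'), Finset.mul_sum]
  exact Finset.sum_congr rfl fun _ _ => by ring

lemma RealCoeff.nu_quad {m : ℕ} {c : ℂ → ℂ} (hc : RealCoeff m c) :
    nu m (quad m c) = ∑ s ∈ Finset.range (2 * m - 2),
      ((dens m s * (act m s * (incr m (comb m c) s).re ^ 2) : ℝ) : ℂ) := by
  unfold nu
  rcases Nat.eq_zero_or_pos m with rfl | hm
  · simp
  rw [show 2 * m - 1 = 2 * m - 2 + 1 by omega, Finset.sum_range_succ]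
  rw [quad, act_last, Nat.cast_zero, zero_mul, smul_zero, add_zero]
  refine Finset.sum_congr rfl fun s hs => ?_
  have h := hc.incr_im (Finset.mem_range.1 hs)
  have h3 : incr m (comb m c) s = ((incr m (comb m c) s).re : ℂ) := by
    apply Complex.ext <;> simp [h]
  rw [quad, h3, Complex.real_smul]
  simp

/-- The limiting covariance form, as a bilinear form in the coefficients. -/
noncomputable def cov (m : ℕ) (c d : ℂ → ℂ) : ℂ :=
  ∑ z ∈ spec m, ∑ z' ∈ spec m, c z * d z' * (nu m (quadCoeff m z z') / (1 - z - z'))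

lemma one_sub_sub_ne {m : ℕ} (h2 : 2 ≤ m) (h26 : m ≤ 26) {z z' : ℂ} (hz : z ∈ spec m)
    (hz' : z' ∈ spec m) : 1 - z - z' ≠ 0 := by
  intro h
  have := congrArg Complex.re h
  simp only [Complex.sub_re, Complex.one_re, Complex.zero_re] at this
  have h3 := re_lt_half_of_mem_spec h2 h26 hz
  have h4 := re_lt_half_of_mem_spec h2 h26 hz'
  linarith

lemma cov_comm (m : ℕ) (c d : ℂ → ℂ) : cov m c d = cov m d c := by
  unfold cov
  rw [Finset.sum_comm]
  refine Finset.sum_congr rfl fun z _ => Finset.sum_congr rfl fun z' _ => ?_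
  have : quadCoeff m z' z = quadCoeff m z z' := by funext s; unfold quadCoeff; ring
  rw [this, mul_comm (c z'), show 1 - z' - z = 1 - z - z' by ring]

lemma cov_add_smul (m : ℕ) (c d e : ℂ → ℂ) (a : ℂ) :
    cov m (fun z => c z + a * d z) e = cov m c e + a * cov m d e := by
  unfold cov
  simp only [Finset.mul_sum, ← Finset.sum_add_distrib]
  exact Finset.sum_congr rfl fun _ _ => Finset.sum_congr rfl fun _ _ => by ring

lemma cov_smul (m : ℕ) (c e : ℂ → ℂ) (a : ℂ) :
    cov m (fun z => a * c z) e = a * cov m c e := by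
  unfold cov
  simp only [Finset.mul_sum]
  exact Finset.sum_congr rfl fun _ _ => Finset.sum_congr rfl fun _ _ => by ring

lemma cov_lyapunov {m : ℕ} (h2 : 2 ≤ m) (h26 : m ≤ 26) (c : ℂ → ℂ) :
    cov m c c - 2 * cov m (fun z => z * c z) c = nu m (quad m c) := by
  have h1 : 2 * cov m (fun z => z * c z) c =
      cov m (fun z => z * c z) c + cov m c (fun z => z * c z) := by rw [cov_comm m c]; ring
  rw [h1, nu_quad_eq_sum]
  unfold cov
  rw [← Finset.sum_add_distrib, ← Finset.sum_sub_distrib]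
  refine Finset.sum_congr rfl fun z hz => ?_
  rw [← Finset.sum_add_distrib, ← Finset.sum_sub_distrib]
  refine Finset.sum_congr rfl fun z' hz' => ?_
  have := one_sub_sub_ne h2 h26 hz hz'
  field_simp
  ring

/-! ### One step of the recursion for the characteristic function -/

/-- The coefficients propagated from step `n` to step `n - 1`. -/
noncomputable def prev (n : ℕ) (c : ℂ → ℂ) (z : ℂ) : ℂ := c z + ((n : ℝ)⁻¹ : ℝ) * (z * c z)

lemma RealCoeff.prev {m : ℕ} (h2 : 2 ≤ m) {c : ℂ → ℂ} (hc : RealCoeff m c) (n : ℕ) :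
    RealCoeff m (prev n c) := hc.add_smul (hc.mul h2) _

lemma comb_prev {m : ℕ} (n : ℕ) (c : ℂ → ℂ) (s : ℕ) :
    comb m (prev n c) s = comb m c s + ((n : ℝ)⁻¹ : ℝ) * comb m (fun z => z * c z) s :=
  comb_add_smul c (fun z => z * c z) _ s

lemma stat_comb_prev {m : ℕ} (n : ℕ) (c : ℂ → ℂ) (T : MTree m) :
    stat (comb m (prev n c)) T =
      stat (comb m c) T + ((n : ℝ)⁻¹ : ℝ) * stat (comb m (fun z => z * c z)) T := by
  rw [← stat_const_mul, ← stat_add]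
  congr 1
  funext s
  exact comb_prev n c s

lemma cov_prev_bound {m : ℕ} : ∃ K : ℝ, 0 ≤ K ∧ (2 ≤ m → m ≤ 26 → ∀ (n : ℕ) (c : ℂ → ℂ),
    ‖((n : ℂ) + 1) * cov m c c - n * cov m (prev (n + 1) c) (prev (n + 1) c) - nu m (quad m c)‖ ≤
      cnorm m c ^ 2 * (K / (n + 1))) := by
  obtain ⟨K, hK0, hK⟩ := exists_bound₂ (spec m) fun z z' =>
    ‖nu m (quadCoeff m z z') / (1 - z - z')‖ * (‖z + z'‖ + ‖z * z'‖)
  refine ⟨K, hK0, fun h2 h26 n c => ?_⟩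
  have h1 : ((n : ℂ) + 1) * cov m c c - n * cov m (prev (n + 1) c) (prev (n + 1) c) -
      nu m (quad m c) = ∑ z ∈ spec m, ∑ z' ∈ spec m, c z * c z' *
        (nu m (quadCoeff m z z') / (1 - z - z') *
          (((z + z') - (n / (n + 1)) * (z * z')) / (n + 1))) := by
    rw [nu_quad_eq_sum]
    unfold cov
    simp only [Finset.mul_sum, ← Finset.sum_sub_distrib]
    refine Finset.sum_congr rfl fun z hz => Finset.sum_congr rfl fun z' hz' => ?_
    have := one_sub_sub_ne h2 h26 hz hz'
    have h3 : (n : ℂ) + 1 ≠ 0 := by exact_mod_cast Nat.succ_ne_zero n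
    unfold MSTpaper.prev
    push_cast
    field_simp
    ring
  rw [h1]
  refine norm_sum_sum_le_cnorm fun z hz z' hz' => ?_
  have h4 : ‖(n : ℂ) + 1‖ = n + 1 := by
    have : ((n : ℂ) + 1) = ((n + 1 : ℕ) : ℂ) := by push_cast; rfl
    rw [this, Complex.norm_natCast]; push_cast; rfl
  have h5 : ‖(z + z') - (n / (n + 1)) * (z * z')‖ ≤ ‖z + z'‖ + ‖z * z'‖ := by
    refine (norm_sub_le _ _).trans ?_
    rw [norm_mul ((n : ℂ) / (n + 1)), norm_div, h4, Complex.norm_natCast]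
    have h6 : (n : ℝ) / (n + 1) ≤ 1 := by
      rw [div_le_one (by positivity)]; linarith
    have := mul_le_mul_of_nonneg_right h6 (norm_nonneg (z * z'))
    linarith
  rw [norm_mul, norm_div _ ((n : ℂ) + 1), h4, ← mul_div_assoc]
  refine div_le_div_of_nonneg_right ?_ (by positivity)
  exact le_trans (mul_le_mul_of_nonneg_left h5 (norm_nonneg _)) (hK z hz z' hz')

lemma cov_bound (m : ℕ) : ∃ K : ℝ, 0 ≤ K ∧ ∀ c : ℂ → ℂ, ‖cov m c c‖ ≤ cnorm m c ^ 2 * K := by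
  obtain ⟨K, hK0, hK⟩ := exists_bound₂ (spec m) fun z z' =>
    ‖nu m (quadCoeff m z z') / (1 - z - z')‖
  exact ⟨K, hK0, fun c => norm_sum_sum_le_cnorm hK⟩

lemma nu_quad_bound (m : ℕ) :
    ∃ K : ℝ, 0 ≤ K ∧ ∀ c : ℂ → ℂ, ‖nu m (quad m c)‖ ≤ cnorm m c ^ 2 * K := by
  obtain ⟨K, hK0, hK⟩ := exists_bound₂ (spec m) fun z z' => ‖nu m (quadCoeff m z z')‖
  refine ⟨K, hK0, fun c => ?_⟩
  rw [nu_quad_eq_sum]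
  exact norm_sum_sum_le_cnorm hK

lemma avg_quad_bound {m : ℕ} (h2 : 2 ≤ m) (h26 : m ≤ 26) : ∃ K : ℝ, 0 ≤ K ∧
    ∀ (n : ℕ) (c : ℂ → ℂ), n ≠ 0 →
      avg m n (fun T => ‖stat (quad m c) T - ((n : ℂ) + 1) * nu m (quad m c)‖) ≤
        cnorm m c ^ 2 * (K * Real.sqrt n) := by
  choose K hK0 hK using fun z z' => avg_stat_sub_nu_le h2 h26 (quadCoeff m z z')
  refine ⟨∑ z ∈ spec m, ∑ z' ∈ spec m, K z z',
    Finset.sum_nonneg fun z _ => Finset.sum_nonneg fun z' _ => hK0 z z', fun n c hn => ?_⟩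
  calc _ ≤ avg m n (fun T => cnorm m c ^ 2 * ∑ z ∈ spec m, ∑ z' ∈ spec m,
        ‖stat (quadCoeff m z z') T - ((n : ℂ) + 1) * nu m (quadCoeff m z z')‖) := by
        refine avg_mono fun π => ?_
        have h1 : stat (quad m c) (mst m n π) - ((n : ℂ) + 1) * nu m (quad m c) =
            ∑ z ∈ spec m, ∑ z' ∈ spec m, c z * c z' * (stat (quadCoeff m z z') (mst m n π) -
              ((n : ℂ) + 1) * nu m (quadCoeff m z z')) := by
          rw [stat_quad_eq_sum, nu_quad_eq_sum]
          simp only [Finset.mul_sum, ← Finset.sum_sub_distrib]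
          exact Finset.sum_congr rfl fun _ _ => Finset.sum_congr rfl fun _ _ => by ring
        rw [h1]
        refine norm_sum_sum_le_cnorm fun z hz z' hz' => ?_
        refine le_trans (Finset.single_le_sum (f := fun z' =>
          ‖stat (quadCoeff m z z') (mst m n π) - ((n : ℂ) + 1) * nu m (quadCoeff m z z')‖)
          (fun _ _ => norm_nonneg _) hz') ?_
        exact Finset.single_le_sum (f := fun z => ∑ z' ∈ spec m,
          ‖stat (quadCoeff m z z') (mst m n π) - ((n : ℂ) + 1) * nu m (quadCoeff m z z')‖)
          (fun _ _ => Finset.sum_nonneg fun _ _ => norm_nonneg _) hz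
    _ = cnorm m c ^ 2 * ∑ z ∈ spec m, ∑ z' ∈ spec m,
        avg m n (fun T => ‖stat (quadCoeff m z z') T - ((n : ℂ) + 1) *
          nu m (quadCoeff m z z')‖) := by
        rw [avg_const_mul, avg_finset_sum]
        simp only [avg_finset_sum]
    _ ≤ _ := by
        refine mul_le_mul_of_nonneg_left ?_ (sq_nonneg _)
        simp only [Finset.sum_mul]
        exact Finset.sum_le_sum fun z _ => Finset.sum_le_sum fun z' _ => hK z z' n hn

lemma avg_comb_sq_bound {m : ℕ} (h2 : 2 ≤ m) (h26 : m ≤ 26) : ∃ K : ℝ, 0 ≤ K ∧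
    ∀ (n : ℕ) (c : ℂ → ℂ), n ≠ 0 →
      avg m n (fun T => ‖stat (comb m c) T‖ ^ 2) ≤ cnorm m c ^ 2 * (K * n) := by
  choose! K hK0 hK using fun z (hz : z ∈ spec m) => second_moment_le h2 h26 hz
  refine ⟨∑ z ∈ spec m, K z, Finset.sum_nonneg hK0, fun n c hn => ?_⟩
  calc _ ≤ avg m n (fun T => cnorm m c ^ 2 * ∑ z ∈ spec m, ‖stat (eig m z) T‖ ^ 2) := by
        refine avg_mono fun π => ?_
        rw [stat_comb]
        have h0 : 0 ≤ ∑ z ∈ spec m, ‖stat (eig m z) (mst m n π)‖ ^ 2 :=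
          Finset.sum_nonneg fun _ _ => sq_nonneg _
        rw [← Real.sq_sqrt h0, ← mul_pow]
        refine pow_le_pow_left₀ (norm_nonneg _) (norm_sum_le_cnorm fun z hz => ?_) 2
        apply Real.le_sqrt_of_sq_le
        exact Finset.single_le_sum (f := fun z => ‖stat (eig m z) (mst m n π)‖ ^ 2)
          (fun _ _ => sq_nonneg _) hz
    _ = cnorm m c ^ 2 * ∑ z ∈ spec m, avg m n (fun T => ‖stat (eig m z) T‖ ^ 2) := by
        rw [avg_const_mul, avg_finset_sum]
    _ ≤ _ := by
        refine mul_le_mul_of_nonneg_left ?_ (sq_nonneg _)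
        rw [Finset.sum_mul]
        exact Finset.sum_le_sum fun z hz => hK z hz n hn

lemma incr_comb_bound (m : ℕ) : ∃ D : ℝ, 0 ≤ D ∧ ∀ c : ℂ → ℂ, ∀ s < 2 * m - 1,
    ‖incr m (comb m c) s‖ ≤ cnorm m c * D := by
  choose g hg0 hg using fun z => exists_bound_range (2 * m - 1) (fun s => ‖incr m (eig m z) s‖)
  obtain ⟨D, hD0, hD⟩ := exists_bound (spec m) g
  refine ⟨D, hD0, fun c s hs => ?_⟩
  rw [incr_comb]
  exact norm_sum_le_cnorm fun z hz => (hg z s hs).trans (hD z hz)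

lemma norm_exp_I_mul_of_im_eq_zero {x : ℂ} (h : x.im = 0) : ‖Complex.exp (Complex.I * x)‖ = 1 := by
  rw [Complex.norm_exp]; simp [h]

lemma RealCoeff.stat_im {m : ℕ} (h2 : 2 ≤ m) {c : ℂ → ℂ} (hc : RealCoeff m c) {T : MTree m}
    (hT : Valid T) : (stat (comb m c) T).im = 0 := by
  have h : stat (fun s => (comb m c s).im) T = (stat (comb m c) T).im :=
    stat_map Complex.imAddGroupHom _ T
  rw [← h, stat_congr h2 hT (w := fun _ => (0 : ℝ)) hc]
  simp [stat]

lemma norm_exp_sub_two_le (x : ℂ) :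
    ‖Complex.exp x - (1 + x)‖ ≤ ‖x‖ ^ 2 * Real.exp ‖x‖ := by
  have := Complex.norm_exp_sub_sum_le_norm_mul_exp x 2
  simpa [Finset.sum_range_succ] using this

lemma norm_exp_sub_three_le (x : ℂ) :
    ‖Complex.exp x - (1 + x + x ^ 2 / 2)‖ ≤ ‖x‖ ^ 3 * Real.exp ‖x‖ := by
  have := Complex.norm_exp_sub_sum_le_norm_mul_exp x 3
  simpa [Finset.sum_range_succ] using this

lemma step_pointwise {m : ℕ} (h2 : 2 ≤ m) {T : MTree m} (hT : Valid T) (h0 : T ≠ MTree.lf 0)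
    {c : ℂ → ℂ} (hc : RealCoeff m c) {D R G r : ℝ} (hR : cnorm m c ≤ R) (hD0 : 0 ≤ D)
    (hD : ∀ s < 2 * m - 1, ‖incr m (comb m c) s‖ ≤ cnorm m c * D) (hr : |r| ≤ G) {n : ℕ}
    (hn : T.keys = n) :
    ‖((n : ℂ) + 1)⁻¹ * stat (fun s => (act m s : ℂ) *
        Complex.exp (Complex.I * (stat (comb m c) T + incr m (comb m c) s))) T -
      Complex.exp (-(r : ℂ) / 2) * Complex.exp (Complex.I * stat (comb m (prev (n + 1) c)) T)‖ ≤
    ‖stat (quad m c) T / (n + 1) - r‖ / 2 + (cnorm m c * D) ^ 3 * Real.exp (R * D) +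
      (r ^ 2 / 2 + 2 * (‖stat (comb m (fun z => z * c z)) T‖ / (n + 1)) ^ 2) *
        Real.exp (G / 2 + R * D) := by
  set S := stat (comb m c) T with hS
  set δ := incr m (comb m c) with hδ
  set B := stat (comb m (fun z => z * c z)) T with hB
  set Q := stat (quad m c) T with hQ
  set x := cnorm m c with hx
  have hx0 : 0 ≤ x := cnorm_nonneg _ _
  have hN : ((n : ℂ) + 1) ≠ 0 := by exact_mod_cast Nat.succ_ne_zero n
  have hN' : (0 : ℝ) < n + 1 := by positivity
  have hNn : ‖(n : ℂ) + 1‖ = n + 1 := by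
    have : ((n : ℂ) + 1) = ((n + 1 : ℕ) : ℂ) := by push_cast; rfl
    rw [this, Complex.norm_natCast]; push_cast; rfl
  have hBs : stat (fun s => (act m s : ℂ) * δ s) T = B :=
    stat_congr h2 hT fun s hs => act_mul_incr_comb h2 c hs
  have hkeys : ((T.keys : ℕ) : ℂ) = n := by rw [hn]
  set e : ℕ → ℂ := fun s => Complex.exp (Complex.I * δ s) -
    (1 + Complex.I * δ s + (Complex.I * δ s) ^ 2 / 2) with he
  have hE : ‖stat (fun s => (act m s : ℂ) * e s) T‖ ≤
      (n + 1) * ((x * D) ^ 3 * Real.exp (R * D)) := by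
    rw [← hn]
    refine norm_stat_act_mul_le h2 hT h0 fun s hs => ?_
    refine (norm_exp_sub_three_le _).trans ?_
    have h3 : ‖Complex.I * δ s‖ ≤ x * D := by simpa using hD s hs
    gcongr
    exact h3.trans (by gcongr)
  have h4 : stat (fun s => (act m s : ℂ) * Complex.exp (Complex.I * (S + δ s))) T =
      Complex.exp (Complex.I * S) * (((n : ℂ) + 1) + (Complex.I * B + ((-1 / 2) * Q +
        stat (fun s => (act m s : ℂ) * e s) T))) := by
    have h9 : (fun s => (act m s : ℂ) * Complex.exp (Complex.I * (S + δ s))) =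
        fun s => Complex.exp (Complex.I * S) * ((act m s : ℂ) +
          (Complex.I * ((act m s : ℂ) * δ s) + ((-1 / 2) * quad m c s + (act m s : ℂ) * e s))) := by
      funext s
      rw [mul_add, Complex.exp_add]
      simp only [he, quad, mul_pow, Complex.I_sq]
      ring
    rw [h9, stat_const_mul, stat_add, stat_add, stat_add, stat_const_mul, stat_const_mul, hBs,
      stat_act h2 T hT h0, hkeys]
  have h5 : Complex.exp (-(r : ℂ) / 2) *
      Complex.exp (Complex.I * stat (comb m (prev (n + 1) c)) T) =
      Complex.exp (Complex.I * S) * Complex.exp (-(r : ℂ) / 2 + Complex.I * (B / (n + 1))) := by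
    rw [stat_comb_prev, ← Complex.exp_add, ← Complex.exp_add]
    congr 1
    push_cast
    field_simp
    ring
  set y : ℂ := -(r : ℂ) / 2 + Complex.I * (B / (n + 1)) with hy
  have hM : ‖B / ((n : ℂ) + 1)‖ = ‖B‖ / (n + 1) := by rw [norm_div, hNn]
  have hMle : ‖B‖ / (n + 1) ≤ R * D := by
    rw [div_le_iff₀ hN', ← hBs]
    have := norm_stat_act_mul_le h2 hT h0 hD
    rw [hn] at this
    refine this.trans ?_
    rw [mul_comm]
    gcongr
  have hyn : ‖y‖ ≤ |r| / 2 + ‖B‖ / (n + 1) := by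
    refine (norm_add_le _ _).trans (le_of_eq ?_)
    rw [norm_mul, Complex.norm_I, one_mul, hM, norm_div, norm_neg, Complex.norm_real,
      Real.norm_eq_abs]
    simp
  have hy2 : ‖y‖ ^ 2 ≤ r ^ 2 / 2 + 2 * (‖B‖ / (n + 1)) ^ 2 := by
    have h6 : ‖y‖ ^ 2 ≤ (|r| / 2 + ‖B‖ / (n + 1)) ^ 2 := by gcongr
    have h7 := sq_nonneg (|r| / 2 - ‖B‖ / (n + 1))
    have h8 := sq_abs r
    nlinarith
  have h6 : ((n : ℂ) + 1)⁻¹ * (Complex.exp (Complex.I * S) * (((n : ℂ) + 1) +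
      (Complex.I * B + ((-1 / 2) * Q + stat (fun s => (act m s : ℂ) * e s) T)))) -
      Complex.exp (Complex.I * S) * Complex.exp y = Complex.exp (Complex.I * S) *
      ((-1 / 2) * (Q / (n + 1) - r) + (stat (fun s => (act m s : ℂ) * e s) T / (n + 1) -
        (Complex.exp y - (1 + y)))) := by
    rw [hy]
    field_simp
    ring
  rw [h4, h5, h6, norm_mul, norm_exp_I_mul_of_im_eq_zero (hc.stat_im h2 hT), one_mul, add_assoc]
  refine (norm_add_le _ _).trans (add_le_add (le_of_eq ?_) ((norm_sub_le _ _).trans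
    (add_le_add ?_ ?_)))
  · rw [norm_mul]; norm_num; ring
  · rw [norm_div, hNn, div_le_iff₀ hN', mul_comm]; exact hE
  · refine (norm_exp_sub_two_le y).trans ?_
    gcongr
    exact hyn.trans (by linarith)

/-! ### The characteristic function -/

/-- The characteristic function of the statistic with coefficients `c`. -/
noncomputable def cf (m n : ℕ) (c : ℂ → ℂ) : ℂ :=
  avg m n (fun T => Complex.exp (Complex.I * stat (comb m c) T))

/-- The limiting variance per key. -/
noncomputable def lvar (m : ℕ) (c : ℂ → ℂ) : ℝ := (cov m c c).re

lemma RealCoeff.nu_quad_eq_re {m : ℕ} {c : ℂ → ℂ} (hc : RealCoeff m c) :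
    nu m (quad m c) = ((nu m (quad m c)).re : ℝ) := by
  rw [hc.nu_quad, ← Complex.ofReal_sum, Complex.ofReal_re]

lemma lvar_prev_bound (m : ℕ) : ∃ K : ℝ, 0 ≤ K ∧ (2 ≤ m → m ≤ 26 → ∀ (n : ℕ) (c : ℂ → ℂ),
    RealCoeff m c →
      ‖nu m (quad m c) - ((((n : ℝ) + 1) * lvar m c - n * lvar m (prev (n + 1) c) : ℝ) : ℂ)‖ ≤
        cnorm m c ^ 2 * (K / (n + 1))) := by
  obtain ⟨K, hK0, hK⟩ := cov_prev_bound (m := m)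
  refine ⟨K, hK0, fun h2 h26 n c hc => ?_⟩
  refine le_trans ?_ (hK h2 h26 n c)
  rw [norm_sub_rev]
  rw [hc.nu_quad_eq_re, ← Complex.ofReal_sub, Complex.norm_real, Real.norm_eq_abs]
  refine le_trans (le_of_eq ?_) (Complex.abs_re_le_norm _)
  congr 1
  have h1 : ((n : ℂ) + 1) = (((n : ℝ) + 1 : ℝ) : ℂ) := by push_cast; rfl
  have h2 : (n : ℂ) = ((n : ℝ) : ℂ) := by push_cast; rfl
  rw [h1, h2, Complex.sub_re, Complex.sub_re, Complex.re_ofReal_mul, Complex.re_ofReal_mul,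
    Complex.ofReal_re]
  rfl

lemma cf_step {m : ℕ} (h2 : 2 ≤ m) (h26 : m ≤ 26) {R : ℝ} (hR : 0 ≤ R) :
    ∃ C : ℝ, 0 ≤ C ∧ ∀ (n : ℕ) (c : ℂ → ℂ), n ≠ 0 → RealCoeff m c →
      (n + 1) * cnorm m c ^ 2 ≤ R ^ 2 →
      ‖cf m (n + 1) c - Complex.exp
          (-(((((n : ℝ) + 1) * lvar m c - n * lvar m (prev (n + 1) c) : ℝ)) : ℂ) / 2) *
        cf m n (prev (n + 1) c)‖ ≤ C * (cnorm m c / (n + 1)) := by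
  obtain ⟨K₁, hK₁0, hK₁⟩ := lvar_prev_bound m
  obtain ⟨K₂, hK₂0, hK₂⟩ := nu_quad_bound m
  obtain ⟨Q, hQ0, hQ⟩ := avg_quad_bound h2 h26
  obtain ⟨B, hB0, hB⟩ := avg_comb_sq_bound h2 h26
  obtain ⟨D, hD0, hD⟩ := incr_comb_bound m
  obtain ⟨Z, hZ0, hZ⟩ := exists_bound (spec m) (fun z => ‖z‖)
  set G := R ^ 2 * (K₁ + K₂) with hG
  set E := Real.exp (G / 2 + R * D) with hE
  have hE0 : 0 < E := Real.exp_pos _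
  refine ⟨R * (Q + K₁) / 2 + R ^ 2 * D ^ 3 * Real.exp (R * D) +
    (R ^ 3 * (K₁ + K₂) ^ 2 / 2 + 2 * (R * Z ^ 2 * B)) * E, by positivity,
    fun n c hn hc hcR => ?_⟩
  set x := cnorm m c with hx
  have hx0 : 0 ≤ x := cnorm_nonneg _ _
  set N : ℝ := n + 1 with hN
  have hN1 : 1 ≤ N := by simp [hN]
  have hN0 : 0 < N := by linarith
  set r : ℝ := N * lvar m c - n * lvar m (prev (n + 1) c) with hr
  have hxR : x ≤ R := by
    refine le_of_sq_le_sq ?_ hR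
    nlinarith [sq_nonneg x]
  have hx2 : x ^ 2 ≤ R ^ 2 / N := by rw [le_div_iff₀ hN0]; linarith
  have hxs : x * Real.sqrt n ≤ R := by
    refine le_of_sq_le_sq ?_ hR
    rw [mul_pow, Real.sq_sqrt (Nat.cast_nonneg n)]
    nlinarith [sq_nonneg x]
  have hr1 : ‖nu m (quad m c) - r‖ ≤ x ^ 2 * (K₁ / N) := hK₁ h2 h26 n c hc
  have hrabs : |r| ≤ x ^ 2 * (K₁ + K₂) := by
    have h3 : ‖(r : ℂ)‖ ≤ ‖nu m (quad m c)‖ + ‖nu m (quad m c) - r‖ := by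
      have := norm_sub_le (nu m (quad m c)) (nu m (quad m c) - r)
      simpa using this
    rw [Complex.norm_real, Real.norm_eq_abs] at h3
    have h4 := hK₂ c
    have h5 : K₁ / N ≤ K₁ := div_le_self hK₁0 hN1
    have h6 := mul_le_mul_of_nonneg_left h5 (sq_nonneg x)
    linarith
  have hrG : |r| ≤ G := hrabs.trans (by rw [hG]; gcongr)
  have hr2 : r ^ 2 ≤ R ^ 3 * (K₁ + K₂) ^ 2 * (x / N) := by
    have h3 : r ^ 2 ≤ (x ^ 2 * (K₁ + K₂)) ^ 2 := by rw [← sq_abs]; gcongr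
    have h4 : x ^ 2 * x ≤ (R ^ 2 / N) * R := by gcongr
    calc r ^ 2 ≤ (x ^ 2 * x) * (x * (K₁ + K₂) ^ 2) := by rw [show
          (x ^ 2 * x) * (x * (K₁ + K₂) ^ 2) = (x ^ 2 * (K₁ + K₂)) ^ 2 by ring]; exact h3
      _ ≤ ((R ^ 2 / N) * R) * (x * (K₁ + K₂) ^ 2) := by gcongr
      _ = _ := by ring
  rw [cf, cf, avg_succ_stat h2 hn (comb m c) (fun y => Complex.exp (Complex.I * y)),
    ← avg_const_mul, ← avg_sub]
  refine (norm_avg_le _).trans ?_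
  calc _ ≤ avg m n (fun T => (1 / (2 * N)) * ‖stat (quad m c) T - ((n : ℂ) + 1) *
          nu m (quad m c)‖ + (2 * E / N ^ 2) * ‖stat (comb m (fun z => z * c z)) T‖ ^ 2 +
          (x ^ 2 * (K₁ / N) / 2 + (x * D) ^ 3 * Real.exp (R * D) + r ^ 2 / 2 * E)) := by
        refine avg_mono fun π => ?_
        refine (step_pointwise h2 (valid_mst h2 π) (mst_ne h2 hn π) hc hxR hD0 (hD c) hrG
          (keys_mst h2 π)).trans ?_
        have h3 : ‖stat (quad m c) (mst m n π) / ((n : ℂ) + 1) - r‖ ≤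
            ‖stat (quad m c) (mst m n π) - ((n : ℂ) + 1) * nu m (quad m c)‖ / N +
              x ^ 2 * (K₁ / N) := by
          have h4 : ((n : ℂ) + 1) = (N : ℂ) := by rw [hN]; push_cast; rfl
          have h5 : (N : ℂ) ≠ 0 := by exact_mod_cast hN0.ne'
          have h6 : stat (quad m c) (mst m n π) / ((n : ℂ) + 1) - r =
              (stat (quad m c) (mst m n π) - ((n : ℂ) + 1) * nu m (quad m c)) / N +
                (nu m (quad m c) - r) := by
            rw [h4]; field_simp; ring
          rw [h6]
          refine (norm_add_le _ _).trans (add_le_add (le_of_eq ?_) hr1)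
          rw [norm_div, Complex.norm_real, Real.norm_eq_abs, abs_of_pos hN0]
        rw [← hE, ← hN, div_pow]
        have h7 : (1 / (2 * N)) * ‖stat (quad m c) (mst m n π) - ((n : ℂ) + 1) *
          nu m (quad m c)‖ = (‖stat (quad m c) (mst m n π) - ((n : ℂ) + 1) *
          nu m (quad m c)‖ / N) / 2 := by field_simp
        rw [h7]
        have h8 : (2 * E / N ^ 2) * ‖stat (comb m (fun z => z * c z)) (mst m n π)‖ ^ 2 =
          2 * (‖stat (comb m (fun z => z * c z)) (mst m n π)‖ ^ 2 / N ^ 2) * E := by ring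
        rw [h8]
        linarith
    _ = (1 / (2 * N)) * avg m n (fun T => ‖stat (quad m c) T - ((n : ℂ) + 1) *
          nu m (quad m c)‖) + (2 * E / N ^ 2) *
          avg m n (fun T => ‖stat (comb m (fun z => z * c z)) T‖ ^ 2) +
          (x ^ 2 * (K₁ / N) / 2 + (x * D) ^ 3 * Real.exp (R * D) + r ^ 2 / 2 * E) := by
        rw [avg_add, avg_add, avg_const_mul, avg_const_mul, avg_const]
    _ ≤ (1 / (2 * N)) * (x ^ 2 * (Q * Real.sqrt n)) + (2 * E / N ^ 2) *
          ((Z * x) ^ 2 * (B * N)) + (x ^ 2 * (K₁ / N) / 2 + (x * D) ^ 3 * Real.exp (R * D) +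
            r ^ 2 / 2 * E) := by
        gcongr
        · exact hQ n c hn
        · refine (hB n _ hn).trans ?_
          have h3 := cnorm_mul_le (m := m) (c := c) (f := fun z => z) hZ
          have h4 := cnorm_nonneg m (fun z => z * c z)
          gcongr
          linarith
    _ = (x * Real.sqrt n) * (Q / 2 * (x / N)) + x * (2 * E * Z ^ 2 * B * (x / N)) +
          x * (K₁ / 2 * (x / N)) + x ^ 2 * (x * D ^ 3 * Real.exp (R * D)) + r ^ 2 * (E / 2) := by
        field_simp
        ring
    _ ≤ R * (Q / 2 * (x / N)) + R * (2 * E * Z ^ 2 * B * (x / N)) +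
          R * (K₁ / 2 * (x / N)) + (R ^ 2 / N) * (x * D ^ 3 * Real.exp (R * D)) +
          (R ^ 3 * (K₁ + K₂) ^ 2 * (x / N)) * (E / 2) := by gcongr
    _ = _ := by ring

/-! ### Gaussian approximation of the characteristic function -/

lemma exists_contraction {m : ℕ} (h2 : 2 ≤ m) (h26 : m ≤ 26) : ∃ α : ℝ, 0 < α ∧ α < 1 / 2 ∧
    ∃ n₀ : ℕ, n₀ ≠ 0 ∧ ∀ n ≥ n₀, ∀ c : ℂ → ℂ,
      cnorm m (prev (n + 1) c) ≤ (1 + α / (n + 1)) * cnorm m c := by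
  have h3 : ∀ᶠ α : ℝ in nhdsWithin (1 / 2) (Set.Iio (1 / 2)), ∀ z ∈ spec m, z.re < α :=
    (Filter.eventually_all_finset _).2 fun z hz => mem_nhdsWithin_of_mem_nhds
      (lt_mem_nhds (re_lt_half_of_mem_spec h2 h26 hz))
  have h4 : ∀ᶠ α : ℝ in nhdsWithin (1 / 2) (Set.Iio (1 / 2)), 0 < α :=
    mem_nhdsWithin_of_mem_nhds (lt_mem_nhds (by norm_num))
  obtain ⟨α, hα, hα0, hα2⟩ := (h3.and (h4.and self_mem_nhdsWithin)).exists
  have h5 : ∀ᶠ n : ℕ in Filter.atTop, ∀ z ∈ spec m, Complex.normSq z ≤ 2 * (α - z.re) * n :=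
    (Filter.eventually_all_finset _).2 fun z hz =>
      (tendsto_natCast_atTop_atTop.const_mul_atTop
        (by linarith [hα z hz] : 0 < 2 * (α - z.re))).eventually_ge_atTop _
  obtain ⟨n₀, hn₀⟩ := Filter.eventually_atTop.1 h5
  refine ⟨α, hα0, hα2, n₀ + 1, Nat.succ_ne_zero _, fun n hn c => ?_⟩
  have hN : (0 : ℝ) < (n : ℝ) + 1 := by positivity
  have h6 : prev (n + 1) c = fun z => (1 + (((n + 1 : ℕ) : ℝ)⁻¹ : ℝ) * z) * c z := by
    funext z; unfold prev; ring
  rw [h6]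
  refine cnorm_mul_le fun z hz => ?_
  have h7 := hn₀ (n + 1) (by omega) z hz
  push_cast at h7 ⊢
  refine le_of_sq_le_sq ?_ (by positivity)
  rw [← Complex.normSq_eq_norm_sq]
  have h8 : ((n : ℂ) + 1)⁻¹ = ((((n : ℝ) + 1)⁻¹ : ℝ) : ℂ) := by push_cast; rfl
  rw [h8, Complex.normSq_apply]
  simp only [Complex.add_re, Complex.one_re, Complex.re_ofReal_mul, Complex.add_im,
    Complex.one_im, Complex.im_ofReal_mul, zero_add]
  rw [Complex.normSq_apply] at h7
  set i := ((n : ℝ) + 1)⁻¹ with hi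
  have hi0 : 0 < i := inv_pos.2 hN
  have hiN : i * ((n : ℝ) + 1) = 1 := inv_mul_cancel₀ hN.ne'
  rw [div_eq_mul_inv, ← hi]
  have h9 : i ^ 2 * (z.re * z.re + z.im * z.im) ≤ 2 * (α - z.re) * i := by
    calc _ ≤ i ^ 2 * (2 * (α - z.re) * (n + 1)) := by gcongr
      _ = 2 * (α - z.re) * i * (i * (n + 1)) := by ring
      _ = _ := by rw [hiN, mul_one]
  nlinarith [sq_nonneg (α * i)]

lemma one_add_div_mul_rpow_le {α : ℝ} (h0 : 0 ≤ α) (h1 : α ≤ 1) (n : ℕ) :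
    (1 + α / (n + 1)) * (n : ℝ) ^ α ≤ ((n + 1 : ℕ) : ℝ) ^ α := by
  have hN : (0 : ℝ) < (n : ℝ) + 1 := by positivity
  have hi : 1 / ((n : ℝ) + 1) ≤ 1 := by rw [div_le_one hN]; linarith [(n.cast_nonneg : (0:ℝ) ≤ n)]
  have h2 : (n : ℝ) = (n + 1) * (1 + -(1 / ((n : ℝ) + 1))) := by field_simp; ring
  have h3 : (n : ℝ) ^ α = (n + 1) ^ α * (1 + -(1 / ((n : ℝ) + 1))) ^ α := by
    rw [← Real.mul_rpow hN.le (by linarith), ← h2]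
  have h4 := rpow_one_add_le_one_add_mul_self (s := -(1 / ((n : ℝ) + 1))) (p := α)
    (by linarith) h0 h1
  rw [h3]
  push_cast
  calc _ = ((n : ℝ) + 1) ^ α * ((1 + α / (n + 1)) * (1 + -(1 / ((n : ℝ) + 1))) ^ α) := by ring
    _ ≤ ((n : ℝ) + 1) ^ α * 1 := by
        gcongr
        calc _ ≤ (1 + α / ((n : ℝ) + 1)) * (1 + α * -(1 / ((n : ℝ) + 1))) := by gcongr
          _ = 1 - (α / ((n : ℝ) + 1)) ^ 2 := by ring
          _ ≤ 1 := by linarith [sq_nonneg (α / ((n : ℝ) + 1))]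
    _ = _ := mul_one _

lemma norm_exp_ofReal_sub_one_le (y : ℝ) :
    ‖Complex.exp y - 1‖ ≤ |y| * Real.exp |y| := by
  have := Complex.norm_exp_sub_sum_le_norm_mul_exp y 1
  simpa [Finset.sum_range_succ] using this

lemma norm_cf_sub_one_le {m : ℕ} (h2 : 2 ≤ m) (h26 : m ≤ 26) : ∃ K : ℝ, 0 ≤ K ∧
    ∀ (n : ℕ) (c : ℂ → ℂ), n ≠ 0 → RealCoeff m c → ‖cf m n c - 1‖ ≤ K * n * cnorm m c := by
  obtain ⟨B, hB0, hB⟩ := avg_comb_sq_bound h2 h26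
  refine ⟨Real.sqrt B, Real.sqrt_nonneg _, fun n c hn hc => ?_⟩
  have hn1 : (1 : ℝ) ≤ n := by exact_mod_cast Nat.one_le_iff_ne_zero.2 hn
  rw [cf, ← avg_const (m := m) (n := n) (1 : ℂ), ← avg_sub]
  calc _ ≤ avg m n (fun T => ‖stat (comb m c) T‖) := by
        refine (norm_avg_le _).trans (avg_mono fun π => ?_)
        have h3 : stat (comb m c) (mst m n π) = ((stat (comb m c) (mst m n π)).re : ℝ) :=
          (Complex.ext (by simp) (by simp [hc.stat_im h2 (valid_mst h2 π)]))
        rw [h3, Complex.norm_real]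
        exact Real.norm_exp_I_mul_ofReal_sub_one_le
    _ ≤ Real.sqrt (cnorm m c ^ 2 * (B * n)) :=
        (avg_norm_le_sqrt _).trans (Real.sqrt_le_sqrt (hB n c hn))
    _ = cnorm m c * (Real.sqrt B * Real.sqrt n) := by
        rw [Real.sqrt_mul (sq_nonneg _), Real.sqrt_sq (cnorm_nonneg _ _), Real.sqrt_mul hB0]
    _ ≤ cnorm m c * (Real.sqrt B * n) := by
        have := cnorm_nonneg m c
        gcongr
        exact Real.sqrt_le_left (by positivity) |>.2 (by nlinarith)
    _ = _ := by ring

lemma cf_bound {m : ℕ} (h2 : 2 ≤ m) (h26 : m ≤ 26) {R : ℝ} (hR : 0 ≤ R) :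
    ∃ α < (1 / 2 : ℝ), ∃ K : ℝ, ∃ n₀ : ℕ, ∀ n ≥ n₀, ∀ c : ℂ → ℂ, RealCoeff m c →
      n * cnorm m c ^ 2 ≤ R ^ 2 →
      ‖cf m n c * Complex.exp ((n * lvar m c / 2 : ℝ) : ℂ) - 1‖ ≤ K * (n : ℝ) ^ α * cnorm m c := by
  obtain ⟨α, hα0, hα2, n₀, hn₀, hcon⟩ := exists_contraction h2 h26
  obtain ⟨C, hC0, hC⟩ := cf_step h2 h26 hR
  obtain ⟨V, hV0, hV⟩ := cov_bound m
  obtain ⟨A, hA0, hA⟩ := norm_cf_sub_one_le h2 h26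
  have hlvar : ∀ c, |lvar m c| ≤ cnorm m c ^ 2 * V := fun c =>
    (Complex.abs_re_le_norm _).trans (hV c)
  set E := Real.exp (V * R ^ 2) with hE
  have hE0 : 0 < E := Real.exp_pos _
  have hmain : ∀ (n : ℕ) (c : ℂ → ℂ), (n : ℝ) * cnorm m c ^ 2 ≤ R ^ 2 →
      |(n : ℝ) * lvar m c / 2| ≤ V * R ^ 2 := fun n c h => by
    rw [abs_div, abs_mul, abs_of_nonneg (n.cast_nonneg : (0 : ℝ) ≤ n), abs_two]
    have h3 := mul_le_mul_of_nonneg_left (hlvar c) (n.cast_nonneg : (0 : ℝ) ≤ n)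
    have h4 := mul_le_mul_of_nonneg_right h hV0
    have h5 : 0 ≤ V * R ^ 2 := by positivity
    nlinarith
  have hmainE : ∀ (n : ℕ) (c : ℂ → ℂ), (n : ℝ) * cnorm m c ^ 2 ≤ R ^ 2 →
      ‖Complex.exp (((n : ℝ) * lvar m c / 2 : ℝ) : ℂ)‖ ≤ E := fun n c h => by
    rw [Complex.norm_exp_ofReal]
    exact Real.exp_le_exp.2 ((le_abs_self _).trans (hmain n c h))
  set L := C * E / α with hL
  have hL0 : 0 ≤ L := by positivity
  set K₀ := A * n₀ * E + n₀ * V * R * E with hK₀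
  have hn₀1 : (1 : ℝ) ≤ n₀ := by exact_mod_cast Nat.one_le_iff_ne_zero.2 hn₀
  have hK₀0 : 0 ≤ K₀ := by positivity
  have key : ∀ n ≥ n₀, ∀ c : ℂ → ℂ, RealCoeff m c → n * cnorm m c ^ 2 ≤ R ^ 2 →
      ‖cf m n c * Complex.exp ((n * lvar m c / 2 : ℝ) : ℂ) - 1‖ ≤
        ((K₀ + L) * (n : ℝ) ^ α - L) * cnorm m c := by
    intro n hn
    induction n, hn using Nat.le_induction with
    | base =>
      intro c hc hcR
      have hx0 := cnorm_nonneg m c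
      have hxR : cnorm m c ≤ R := by
        refine le_of_sq_le_sq ?_ hR
        nlinarith [sq_nonneg (cnorm m c)]
      have h3 : cf m n₀ c * Complex.exp ((n₀ * lvar m c / 2 : ℝ) : ℂ) - 1 =
          (cf m n₀ c - 1) * Complex.exp ((n₀ * lvar m c / 2 : ℝ) : ℂ) +
            (Complex.exp ((n₀ * lvar m c / 2 : ℝ) : ℂ) - 1) := by ring
      have h4 : |(n₀ : ℝ) * lvar m c / 2| ≤ n₀ * V * R * cnorm m c := by
        rw [abs_div, abs_mul, abs_of_nonneg (n₀.cast_nonneg : (0 : ℝ) ≤ n₀), abs_two]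
        have h5 := mul_le_mul_of_nonneg_left (hlvar c) (n₀.cast_nonneg : (0 : ℝ) ≤ n₀)
        have h6 : cnorm m c ^ 2 * V ≤ (R * cnorm m c) * V := by rw [sq]; gcongr
        have h7 := mul_le_mul_of_nonneg_left h6 (n₀.cast_nonneg : (0 : ℝ) ≤ n₀)
        have h8 : 0 ≤ (n₀ : ℝ) * |lvar m c| := by positivity
        linarith
      have h5 : 1 ≤ (n₀ : ℝ) ^ α := Real.one_le_rpow hn₀1 hα0.le
      calc _ ≤ (A * n₀ * cnorm m c) * E + (n₀ * V * R * cnorm m c) * E := by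
            rw [h3]
            refine (norm_add_le _ _).trans (add_le_add ?_ ?_)
            · rw [norm_mul]
              gcongr
              · exact hA n₀ c hn₀ hc
              · exact hmainE n₀ c hcR
            · refine (norm_exp_ofReal_sub_one_le _).trans ?_
              gcongr
              exact Real.exp_le_exp.2 (hmain n₀ c hcR)
        _ = K₀ * cnorm m c := by rw [hK₀]; ring
        _ ≤ _ := by
            gcongr
            nlinarith
    | succ n hn ih =>
      intro c hc hcR
      have hx0 := cnorm_nonneg m c
      have hn1 : n ≠ 0 := by omega
      have hn1' : (1 : ℝ) ≤ n := by exact_mod_cast Nat.one_le_iff_ne_zero.2 hn1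
      have hN : (0 : ℝ) < (n : ℝ) + 1 := by positivity
      have hcR' : ((n : ℝ) + 1) * cnorm m c ^ 2 ≤ R ^ 2 := by exact_mod_cast hcR
      have hp := hcon n hn c
      have hp0 := cnorm_nonneg m (prev (n + 1) c)
      have hpR : n * cnorm m (prev (n + 1) c) ^ 2 ≤ R ^ 2 := by
        have h3 : cnorm m (prev (n + 1) c) ^ 2 ≤ ((1 + α / (n + 1)) * cnorm m c) ^ 2 := by gcongr
        have h4 : (n : ℝ) * (1 + α / (n + 1)) ^ 2 ≤ n + 1 := by
          rw [show 1 + α / ((n : ℝ) + 1) = (n + 1 + α) / (n + 1) by field_simp, div_pow,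
            ← mul_div_assoc, div_le_iff₀ (by positivity)]
          nlinarith [mul_nonneg hα0.le (by linarith : (0 : ℝ) ≤ 1 / 2 - α),
            mul_nonneg (n.cast_nonneg : (0 : ℝ) ≤ n) (by linarith : (0 : ℝ) ≤ 1 / 2 - α),
            mul_nonneg (mul_nonneg (n.cast_nonneg : (0 : ℝ) ≤ n)
              (n.cast_nonneg : (0 : ℝ) ≤ n)) (by linarith : (0 : ℝ) ≤ 1 / 2 - α),
            mul_nonneg (n.cast_nonneg : (0 : ℝ) ≤ n)
              (mul_nonneg hα0.le (by linarith : (0 : ℝ) ≤ 1 / 2 - α))]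
        calc _ ≤ (n : ℝ) * ((1 + α / (n + 1)) * cnorm m c) ^ 2 := by gcongr
          _ = ((n : ℝ) * (1 + α / (n + 1)) ^ 2) * cnorm m c ^ 2 := by ring
          _ ≤ (n + 1) * cnorm m c ^ 2 := by gcongr
          _ ≤ _ := hcR'
      have h5 := ih (prev (n + 1) c) (hc.prev h2 _) hpR
      have h6 := hC n c hn1 hc hcR'
      set e := Complex.exp ((((n + 1 : ℕ) : ℝ) * lvar m c / 2 : ℝ) : ℂ) with he
      have h7 : Complex.exp (((n : ℝ) * lvar m (prev (n + 1) c) / 2 : ℝ) : ℂ) =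
          Complex.exp (-(((((n : ℝ) + 1) * lvar m c - n * lvar m (prev (n + 1) c) : ℝ)) : ℂ) / 2) *
            e := by
        rw [he, ← Complex.exp_add]
        congr 1
        push_cast
        ring
      have h8 : cf m (n + 1) c * e - 1 = (cf m (n + 1) c - Complex.exp
          (-(((((n : ℝ) + 1) * lvar m c - n * lvar m (prev (n + 1) c) : ℝ)) : ℂ) / 2) *
          cf m n (prev (n + 1) c)) * e + (cf m n (prev (n + 1) c) *
          Complex.exp (((n : ℝ) * lvar m (prev (n + 1) c) / 2 : ℝ) : ℂ) - 1) := by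
        rw [h7]; ring
      have h9 : 0 ≤ (K₀ + L) * (n : ℝ) ^ α - L := by
        have : 1 ≤ (n : ℝ) ^ α := Real.one_le_rpow hn1' hα0.le
        nlinarith
      have h10 := one_add_div_mul_rpow_le hα0.le (by linarith) n
      have h11 : C * E = L * α := by rw [hL]; field_simp
      calc _ ≤ (C * (cnorm m c / (n + 1))) * E +
            ((K₀ + L) * (n : ℝ) ^ α - L) * ((1 + α / (n + 1)) * cnorm m c) := by
            rw [h8]
            refine (norm_add_le _ _).trans (add_le_add ?_ (h5.trans ?_))
            · rw [norm_mul]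
              gcongr
              exact hmainE (n + 1) c hcR
            · gcongr
        _ = (C * E) * (cnorm m c / (n + 1)) +
            ((K₀ + L) * ((1 + α / (n + 1)) * (n : ℝ) ^ α) - L * (1 + α / (n + 1))) * cnorm m c := by
            ring
        _ = ((K₀ + L) * ((1 + α / (n + 1)) * (n : ℝ) ^ α) - L) * cnorm m c := by
            rw [h11]; ring
        _ ≤ _ := by gcongr
  refine ⟨α, hα2, K₀ + L, n₀, fun n hn c hc hcR => (key n hn c hc hcR).trans ?_⟩
  have := cnorm_nonneg m c
  gcongr
  linarith

/-! ### The limiting variance -/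

lemma lvar_smul {m : ℕ} (c : ℂ → ℂ) (a : ℝ) : lvar m (fun z => a * c z) = a ^ 2 * lvar m c := by
  unfold lvar
  rw [cov_smul, cov_comm, cov_smul, ← mul_assoc, ← sq, ← Complex.ofReal_pow, Complex.re_ofReal_mul]

lemma cf_tendsto {m : ℕ} (h2 : 2 ≤ m) (h26 : m ≤ 26) {c : ℂ → ℂ} (hc : RealCoeff m c) (t : ℝ) :
    Filter.Tendsto (fun n : ℕ => cf m n (fun z => ((t / Real.sqrt n : ℝ) : ℂ) * c z)) Filter.atTop
      (nhds (Complex.exp ((-(t ^ 2 * lvar m c / 2) : ℝ) : ℂ))) := by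
  obtain ⟨α, hα, K, n₀, hK⟩ := cf_bound h2 h26 (R := |t| * cnorm m c)
    (mul_nonneg (abs_nonneg _) (cnorm_nonneg _ _))
  have hlim : Filter.Tendsto (fun n : ℕ => K * (|t| * cnorm m c) * (n : ℝ) ^ (-(1 / 2 - α)))
      Filter.atTop (nhds 0) := by
    have := ((tendsto_rpow_neg_atTop (by linarith : 0 < 1 / 2 - α)).comp
      tendsto_natCast_atTop_atTop).const_mul (K * (|t| * cnorm m c))
    simpa using this
  have h1 : Filter.Tendsto (fun n : ℕ => cf m n (fun z => ((t / Real.sqrt n : ℝ) : ℂ) * c z) *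
      Complex.exp ((t ^ 2 * lvar m c / 2 : ℝ) : ℂ) - 1) Filter.atTop (nhds 0) := by
    refine squeeze_zero_norm' ?_ hlim
    filter_upwards [Filter.eventually_ge_atTop n₀, Filter.eventually_gt_atTop 0] with n hn hn0
    have hn0' : (0 : ℝ) < n := by exact_mod_cast hn0
    have hs : (0 : ℝ) < Real.sqrt n := Real.sqrt_pos.2 hn0'
    have hsq : Real.sqrt n ^ 2 = n := Real.sq_sqrt hn0'.le
    have h3 : (n : ℝ) * (t / Real.sqrt n) ^ 2 = t ^ 2 := by
      rw [div_pow, hsq]; field_simp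
    have h4 : cnorm m (fun z => ((t / Real.sqrt n : ℝ) : ℂ) * c z) =
        |t| / Real.sqrt n * cnorm m c := by
      rw [cnorm_smul, Complex.norm_real, Real.norm_eq_abs, abs_div, abs_of_pos hs]
    have h5 := hK n hn _ (hc.smul (t / Real.sqrt n)) (le_of_eq (by
      rw [h4, mul_pow, mul_pow, div_pow, hsq]
      field_simp))
    rw [lvar_smul, ← mul_assoc, h3, h4] at h5
    refine h5.trans (le_of_eq ?_)
    have h6 : (n : ℝ) ^ (-(1 / 2 - α)) = (n : ℝ) ^ α / Real.sqrt n := by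
      rw [Real.sqrt_eq_rpow, ← Real.rpow_sub hn0']; congr 1; ring
    rw [h6]
    ring
  have h7 := (h1.add_const 1).mul_const (Complex.exp ((-(t ^ 2 * lvar m c / 2) : ℝ) : ℂ))
  rw [zero_add, one_mul] at h7
  refine h7.congr fun n => ?_
  rw [sub_add_cancel, mul_assoc, ← Complex.exp_add, ← Complex.ofReal_add]
  simp

lemma lvar_nonneg {m : ℕ} (h2 : 2 ≤ m) (h26 : m ≤ 26) {c : ℂ → ℂ} (hc : RealCoeff m c) :
    0 ≤ lvar m c := by
  have h1 := (cf_tendsto h2 h26 hc 1).norm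
  have h3 : ‖Complex.exp ((-(1 ^ 2 * lvar m c / 2) : ℝ) : ℂ)‖ ≤ 1 := by
    refine le_of_tendsto h1 (Filter.Eventually.of_forall fun n => ?_)
    refine (norm_avg_le _).trans ?_
    rw [← avg_const (m := m) (n := n) (1 : ℝ)]
    exact avg_mono fun π => le_of_eq <| norm_exp_I_mul_of_im_eq_zero
      ((hc.smul _).stat_im h2 (valid_mst h2 π))
  rw [Complex.norm_exp_ofReal, Real.exp_le_one_iff] at h3
  linarith

lemma lvar_add_smul {m : ℕ} (c d : ℂ → ℂ) (a : ℝ) : lvar m (fun z => c z + a * d z) =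
    lvar m c + 2 * a * (cov m d c).re + a ^ 2 * lvar m d := by
  unfold lvar
  rw [cov_add_smul, cov_comm m c, cov_comm m d (fun z => c z + a * d z), cov_add_smul,
    cov_add_smul, cov_comm m c d]
  simp
  ring

lemma incr_eq_zero_of_lvar_eq_zero {m : ℕ} (h2 : 2 ≤ m) (h26 : m ≤ 26) {c : ℂ → ℂ}
    (hc : RealCoeff m c) (h : lvar m c = 0) {s : ℕ} (hs : s < 2 * m - 2) :
    incr m (comb m c) s = 0 := by
  have h1 : (cov m (fun z => z * c z) c).re = 0 := by
    have h3 : ∀ a : ℝ, 0 ≤ lvar m (fun z => z * c z) * (a * a) +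
        2 * (cov m (fun z => z * c z) c).re * a + 0 := fun a => by
      have h4 := lvar_nonneg h2 h26 (hc.add_smul (hc.mul h2) a)
      rw [lvar_add_smul, h] at h4
      linarith
    have h5 := discrim_le_zero h3
    unfold discrim at h5
    nlinarith [sq_nonneg (cov m (fun z => z * c z) c).re]
  have h3 := congrArg Complex.re (cov_lyapunov h2 h26 c)
  rw [hc.nu_quad, ← Complex.ofReal_sum, Complex.ofReal_re] at h3
  have h4 : (2 * cov m (fun z => z * c z) c).re = 0 := by simp [h1]
  rw [Complex.sub_re, h4, sub_zero] at h3
  unfold lvar at h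
  rw [h] at h3
  have hpos : ∀ i ∈ Finset.range (2 * m - 2),
      0 ≤ dens m i * (act m i * (incr m (comb m c) i).re ^ 2) := fun i _ =>
    mul_nonneg (dens_pos h2 i).le (by positivity)
  have h6 := (Finset.sum_eq_zero_iff_of_nonneg hpos).1 h3.symm s (Finset.mem_range.2 hs)
  have h7 : (0 : ℝ) < act m s := by exact_mod_cast act_pos hs
  have h8 := (dens_pos h2 s).ne'
  refine Complex.ext ?_ (hc.incr_im hs)
  simpa [h7.ne', h8] using h6

/-! ### The central limit theorem for the out-degrees -/

lemma exists_degInd_decomp {m k : ℕ} (h2 : 2 ≤ m) (hk : k ≤ m) : ∃ c : ℂ → ℂ, RealCoeff m c ∧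
    ∀ s < 2 * m - 1, (degInd m k s : ℂ) = muDeg m k * act m s + comb m c s := by
  obtain ⟨a, c, h⟩ := exists_decomp h2 (fun s => (degInd m k s : ℂ))
  have h1 : nu m (fun s => (degInd m k s : ℂ)) = (nu m (degInd m k) : ℝ) := by
    simp [nu]
  rw [nu_degInd h2 hk, nu_decomp h2 h] at h1
  subst h1
  refine ⟨c, fun s hs => ?_, h⟩
  have h3 := congrArg Complex.im (h s hs)
  have h4 : ((muDeg m k : ℂ) * (act m s : ℂ)).im = 0 := by simp
  rw [Complex.add_im, h4, Complex.ofReal_im, zero_add] at h3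
  exact h3.symm

lemma incr_comb_degInd {m k : ℕ} (h2 : 2 ≤ m) {c : ℂ → ℂ}
    (h : ∀ s < 2 * m - 1, (degInd m k s : ℂ) = muDeg m k * act m s + comb m c s) {s : ℕ}
    (hs : s < 2 * m - 2) :
    incr m (comb m c) s = ((incr m (degInd m k) s - muDeg m k : ℝ) : ℂ) := by
  have h1 : ∀ s < 2 * m - 1, comb m c s = degInd m k s - muDeg m k * act m s := fun s hs => by
    rw [h s hs]; ring
  have h3 := incr_act h2 hs
  have h4 : ((incr m (degInd m k) s - muDeg m k : ℝ) : ℂ) =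
      ((incr m (degInd m k) s : ℝ) : ℂ) - muDeg m k * incr m (fun s => (act m s : ℂ)) s := by
    rw [h3]; push_cast; ring
  rw [h4]
  simp only [incr]
  rw [h1 s (by omega), h1 (s + 1) (by omega), h1 0 (by omega)]
  split_ifs <;> push_cast <;> ring

lemma exists_incr_degInd_ne {m k : ℕ} (h2 : 2 ≤ m) (hk : k ≤ m) (x : ℝ) :
    ∃ s < 2 * m - 2, incr m (degInd m k) s ≠ x := by
  by_contra! h
  rcases Nat.eq_zero_or_pos k with rfl | hk0
  · have h1 := h (m - 2) (by omega)
    have h3 := h (m - 1) (by omega)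
    rw [← h3] at h1
    simp only [incr, degInd, if_true] at h1
    rw [if_neg (by omega), if_pos le_rfl, if_pos le_rfl, if_pos (by omega), if_neg (by omega),
      if_neg (by omega), if_pos (by omega)] at h1
    norm_num at h1
  · have h1 := h (m - 2 + k - 1) (by omega)
    simp only [incr, degInd, if_neg hk0.ne'] at h1 h
    rw [if_pos (by omega), if_neg (by omega), if_pos (by omega)] at h1
    rcases Nat.lt_or_ge k m with hkm | hkm
    · have h3 := h (m - 2 + k) (by omega)
      rw [if_neg (by omega), if_pos rfl, if_pos (by omega)] at h3
      rw [← h3] at h1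
      norm_num at h1
    · have h3 := h (m - 2 + (m - 2)) (by omega)
      rw [if_neg (by omega), if_neg (by omega), if_pos (by omega)] at h3
      rw [← h3] at h1
      norm_num at h1

lemma lvar_pos {m k : ℕ} (h2 : 2 ≤ m) (h26 : m ≤ 26) (hk : k ≤ m) {c : ℂ → ℂ}
    (hc : RealCoeff m c)
    (h : ∀ s < 2 * m - 1, (degInd m k s : ℂ) = muDeg m k * act m s + comb m c s) :
    0 < lvar m c := by
  refine lt_of_le_of_ne (lvar_nonneg h2 h26 hc) fun h0 => ?_
  obtain ⟨s, hs, hne⟩ := exists_incr_degInd_ne h2 hk (muDeg m k)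
  have h1 := incr_eq_zero_of_lvar_eq_zero h2 h26 hc h0.symm hs
  rw [incr_comb_degInd h2 h hs] at h1
  exact hne (sub_eq_zero.1 (by exact_mod_cast h1))

lemma countOutDeg_sub_eq {m k n : ℕ} (h2 : 2 ≤ m) (hn : n ≠ 0) {c : ℂ → ℂ}
    (h : ∀ s < 2 * m - 1, (degInd m k s : ℂ) = muDeg m k * act m s + comb m c s)
    (π : Equiv.Perm (Fin n)) :
    (((countOutDeg k (mst m n π) : ℝ) - muDeg m k * (n : ℝ) : ℝ) : ℂ) =
      stat (comb m c) (mst m n π) + muDeg m k := by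
  have hT := valid_mst h2 π
  have h1 : (countOutDeg k (mst m n π) : ℝ) = stat (degInd m k) (mst m n π) :=
    countOutDeg_eq h2 k _ hT
  rw [h1, Complex.ofReal_sub, ← stat_ofReal, stat_congr h2 hT h, stat_add, stat_const_mul,
    stat_act h2 _ hT (mst_ne h2 hn π), keys_mst h2 π]
  push_cast
  ring

open MeasureTheory in
/-- The law of a functional of a uniformly random permutation. -/
noncomputable def permLaw {n : ℕ} (X : Equiv.Perm (Fin n) → ℝ) : Measure ℝ :=
  ((Nat.factorial n : ENNReal)⁻¹) • ∑ π, Measure.dirac (X π)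

open MeasureTheory in
instance isProbabilityMeasure_permLaw {n : ℕ} (X : Equiv.Perm (Fin n) → ℝ) :
    IsProbabilityMeasure (permLaw X) := by
  refine ⟨?_⟩
  have h : (Nat.factorial n : ENNReal) ≠ 0 := by exact_mod_cast (Nat.factorial_pos n).ne'
  simp [permLaw, Finset.card_univ, Fintype.card_perm,
    ENNReal.inv_mul_cancel h (ENNReal.natCast_ne_top _)]

open MeasureTheory in
lemma integral_permLaw {n : ℕ} (X : Equiv.Perm (Fin n) → ℝ) {E : Type*} [NormedAddCommGroup E]
    [NormedSpace ℝ E] [CompleteSpace E] (f : ℝ → E) :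
    ∫ x, f x ∂(permLaw X) = ((Nat.factorial n : ℝ)⁻¹) • ∑ π, f (X π) := by
  rw [permLaw, integral_smul_measure, integral_finsetSum_measure]
  · simp
  · exact fun π _ => integrable_dirac (by simp)

open MeasureTheory in
lemma tendstoGauss_of_charFun {W : (n : ℕ) → Equiv.Perm (Fin n) → ℝ} {v : NNReal}
    (h : ∀ t : ℝ, Filter.Tendsto (fun n => ((Nat.factorial n : ℝ)⁻¹) •
      ∑ π, Complex.exp (t * W n π * Complex.I)) Filter.atTop
        (nhds (Complex.exp ((-(t ^ 2 * v / 2) : ℝ) : ℂ)))) : TendstoGauss W v := by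
  obtain ⟨P, hP⟩ : ∃ P : ℕ → ProbabilityMeasure ℝ, ∀ n, (P n : Measure ℝ) = permLaw (W n) :=
    ⟨fun n => ⟨permLaw (W n), inferInstance⟩, fun _ => rfl⟩
  obtain ⟨P₀, hP₀⟩ : ∃ P₀ : ProbabilityMeasure ℝ,
      (P₀ : Measure ℝ) = ProbabilityTheory.gaussianReal 0 v :=
    ⟨⟨ProbabilityTheory.gaussianReal 0 v, inferInstance⟩, rfl⟩
  have h1 : Filter.Tendsto P Filter.atTop (nhds P₀) := by
    rw [ProbabilityMeasure.tendsto_iff_tendsto_charFun]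
    intro t
    simp only [hP, hP₀, charFun_apply_real (μ := permLaw _), integral_permLaw,
      ProbabilityTheory.charFun_gaussianReal]
    convert h t using 3
    push_cast
    ring
  intro f
  have h3 := ProbabilityMeasure.tendsto_iff_forall_integral_tendsto.1 h1 f
  simp only [hP, hP₀, integral_permLaw] at h3
  simpa [pexp, div_eq_inv_mul] using h3

/-- **Theorem (out-degrees in random `m`-ary search trees, `m ≤ 26`).**
Let `D_{n,k}` be the number of nodes with out-degree `k` (`0 ≤ k ≤ m`) in the random
`m`-ary search tree `𝒯_n` with `n` keys. Then `(D_{n,k} - μ_k n)/√n → N(0, σ_k²)`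
for some `σ_k² > 0`, where `μ_0 = (m−1)/(2(H_m−1)(m+1))` and
`μ_k = 1/((H_m−1)m(m+1))` for `1 ≤ k ≤ m`. -/
theorem outdegree_clt (m k : ℕ) (hm : 2 ≤ m) (hm' : m ≤ 26) (hk : k ≤ m) :
    ∃ σ2 : NNReal, 0 < σ2 ∧
      TendstoGauss (fun n π =>
        ((countOutDeg k (mst m n π) : ℝ) - muDeg m k * (n : ℝ)) / Real.sqrt n) σ2 := by
  obtain ⟨c, hc, h⟩ := exists_degInd_decomp hm hk
  have hV := lvar_pos hm hm' hk hc h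
  refine ⟨⟨lvar m c, hV.le⟩, hV, tendstoGauss_of_charFun fun t => ?_⟩
  have h1 : Filter.Tendsto (fun n : ℕ =>
      Complex.exp (((t * muDeg m k / Real.sqrt n : ℝ) : ℂ) * Complex.I)) Filter.atTop (nhds 1) := by
    have h3 : Filter.Tendsto (fun n : ℕ => t * muDeg m k / Real.sqrt n) Filter.atTop (nhds 0) :=
      (Real.tendsto_sqrt_atTop.comp tendsto_natCast_atTop_atTop).const_div_atTop _
    have h4 : Continuous fun x : ℝ => Complex.exp ((x : ℂ) * Complex.I) := by fun_prop
    have h5 := h4.tendsto 0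
    rw [Complex.ofReal_zero, zero_mul, Complex.exp_zero] at h5
    exact h5.comp h3
  have h3 := (cf_tendsto hm hm' hc t).mul h1
  rw [mul_one] at h3
  refine h3.congr' ?_
  filter_upwards [Filter.eventually_ne_atTop 0] with n hn
  rw [cf, mul_comm, ← avg_const_mul, avg]
  congr 1
  refine Finset.sum_congr rfl fun π _ => ?_
  have h5 : comb m (fun z => ((t / Real.sqrt n : ℝ) : ℂ) * c z) =
      fun s => ((t / Real.sqrt n : ℝ) : ℂ) * comb m c s := funext fun s => comb_smul _ _ _
  rw [h5, stat_const_mul, ← Complex.exp_add, Complex.ofReal_div (_ - _) (Real.sqrt n),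
    countOutDeg_sub_eq hm hn h π]
  congr 1
  push_cast
  ring

end MSTpaper
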